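/- arXiv:1902.01745 — 10 statements merged into one kernel-verified Lean document; each statement's English description precedes it below -/
import Mathlib

section
/- Let G be a simple graph on n ≥ 3 vertices such that d(u) + d(v) ≥ n for every pair of distinct non-adjacent vertices u and v of G. Then G is Hamiltonian. -/
namespace SimpleGraph

variable {V : Type*} (G : SimpleGraph V) [DecidableRel G.Adj]

/-- `1` if both arguments are vertices and these are not adjacent, `0` otherwise. -/
def gap : Option V → Option V → ℕ
  | some a, some b => if G.Adj a b then 0 else 1
  | _, _ => 0

/-- The number of consecutive entries of a list of vertices that are not adjacent. -/
def gapCount : List V → ℕ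
  | [] => 0
  | a :: l => G.gap (some a) l.head? + gapCount l

/-- The number of consecutive entries of a list of vertices, read cyclically, that are not
adjacent. -/
def cyclicGapCount (l : List V) : ℕ :=
  G.gapCount l + G.gap l.getLast? l.head?

variable {G}

@[simp] lemma gap_none_left (b : Option V) : G.gap none b = 0 := rfl

@[simp] lemma gap_none_right (a : Option V) : G.gap a none = 0 := by cases a <;> rfl

lemma gap_some_some (a b : V) : G.gap (some a) (some b) = if G.Adj a b then 0 else 1 := rfl

lemma gap_comm (a b : Option V) : G.gap a b = G.gap b a := by
  cases a <;> cases b <;> simp [gap_some_some, G.adj_comm]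

lemma gap_ne_zero {a b : Option V} (h : G.gap a b ≠ 0) :
    ∃ u v, a = some u ∧ b = some v ∧ ¬ G.Adj u v := by
  cases a <;> cases b <;> simp_all [gap_some_some]

lemma gapCount_append (l m : List V) :
    G.gapCount (l ++ m) = G.gapCount l + G.gap l.getLast? m.head? + G.gapCount m := by
  induction l with
  | nil => simp [gapCount]
  | cons a l ih =>
    cases l with
    | nil => simp [gapCount]
    | cons b l =>
      rw [List.cons_append, gapCount, ih, List.getLast?_cons_cons]
      simp [gapCount, add_assoc]

lemma gapCount_reverse (l : List V) : G.gapCount l.reverse = G.gapCount l := by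
  induction l with
  | nil => rfl
  | cons a l ih =>
    rw [List.reverse_cons, gapCount_append, ih, gapCount, gap_comm]
    simp [gapCount, add_comm]

lemma cyclicGapCount_append_comm (l m : List V) :
    G.cyclicGapCount (l ++ m) = G.cyclicGapCount (m ++ l) := by
  by_cases hl : l = []
  · simp [hl]
  by_cases hm : m = []
  · simp [hm]
  simp only [cyclicGapCount, gapCount_append, List.head?_append, List.getLast?_append,
    List.head?_eq_some_head hl, List.head?_eq_some_head hm, List.getLast?_eq_some_getLast hl,
    List.getLast?_eq_some_getLast hm, Option.some_or]
  omega

lemma isChain_of_gapCount_eq_zero {l : List V} (h : G.gapCount l = 0) : l.IsChain G.Adj := by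
  induction l with
  | nil => exact .nil
  | cons a l ih =>
    cases l with
    | nil => exact .singleton a
    | cons b l =>
      rw [gapCount, Nat.add_eq_zero_iff] at h
      refine .cons_cons ?_ (ih h.2)
      simpa [gap_some_some] using h.1

lemma exists_append_of_gapCount_ne_zero {l : List V} (h : G.gapCount l ≠ 0) :
    ∃ A B, l = A ++ B ∧ G.gap A.getLast? B.head? ≠ 0 := by
  induction l with
  | nil => exact absurd rfl h
  | cons a l ih =>
    by_cases h0 : G.gapCount l = 0
    · exact ⟨[a], l, rfl, by simpa [gapCount, h0] using h⟩
    · obtain ⟨A, B, rfl, hAB⟩ := ih h0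
      refine ⟨a :: A, B, rfl, ?_⟩
      cases A with
      | nil => simp at hAB
      | cons b A => simpa [List.getLast?_cons_cons] using hAB

/-- A cyclic list with a gap can be rotated so that its last and first entries form a gap. -/
lemma exists_perm_gap_getLast?_head?_ne_zero {l : List V} (h : G.cyclicGapCount l ≠ 0) :
    ∃ m, m.Perm l ∧ G.cyclicGapCount m = G.cyclicGapCount l ∧ G.gap m.getLast? m.head? ≠ 0 := by
  by_cases h0 : G.gapCount l = 0
  · exact ⟨l, .refl l, rfl, by simpa [cyclicGapCount, h0] using h⟩
  · obtain ⟨A, B, rfl, hAB⟩ := exists_append_of_gapCount_ne_zero h0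
    refine ⟨B ++ A, List.perm_append_comm, cyclicGapCount_append_comm B A, ?_⟩
    obtain ⟨u, v, hu, hv, -⟩ := gap_ne_zero hAB
    simpa [hu, hv] using hAB

end SimpleGraph

lemma List.Nodup.length_eq_card_of_forall_mem {α : Type*} [Fintype α] {l : List α}
    (hl : l.Nodup) (hmem : ∀ x, x ∈ l) : l.length = Fintype.card α := by
  classical
  rw [← List.toFinset_card_of_nodup hl, ← Finset.card_univ]
  congr 1
  ext x
  simp [hmem]

/-- If the number of entries satisfying `p`, not counting the last entry, and the number of entries
satisfying `q`, not counting the first entry, add up to at least the length of the list, then some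
entry satisfying `p` is immediately followed by one satisfying `q`. -/
lemma List.exists_append_of_length_le_countP_add_countP {α : Type*} (p q : α → Bool) {l : List α}
    (hl : l ≠ []) (h : l.length ≤ l.dropLast.countP p + l.tail.countP q) :
    ∃ A B a b, l = A ++ B ∧ A.getLast? = some a ∧ B.head? = some b ∧ p a ∧ q b := by
  induction l with
  | nil => exact absurd rfl hl
  | cons a l ih =>
    cases l with
    | nil => simp at h
    | cons b l =>
      by_cases hab : p a ∧ q b
      · exact ⟨[a], b :: l, a, b, rfl, rfl, rfl, hab⟩
      · obtain ⟨A, B, x, y, hAB, hx, hy, hp⟩ := ih (List.cons_ne_nil _ _) (by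
          simp only [List.dropLast_cons_cons, List.countP_cons, List.tail_cons,
            List.length_cons] at h ⊢
          split_ifs at h <;> first | omega | simp_all)
        refine ⟨a :: A, B, x, y, by rw [hAB, List.cons_append], ?_, hy, hp⟩
        cases A with
        | nil => simp at hx
        | cons c A => simpa [List.getLast?_cons_cons] using hx

namespace SimpleGraph

variable {V : Type*} [Fintype V] [DecidableEq V] {G : SimpleGraph V} [DecidableRel G.Adj]

lemma countP_adj_eq_degree {l : List V} (hl : l.Nodup) (hmem : ∀ x, x ∈ l) (v : V) :
    l.countP (G.Adj v ·) = G.degree v := by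
  rw [List.countP_eq_length_filter, ← List.toFinset_card_of_nodup (hl.filter _),
    ← card_neighborFinset_eq_degree]
  congr 1
  ext x
  simp [hmem]

lemma exists_cyclicGapCount_lt
    (hOre : ∀ u v : V, u ≠ v → ¬ G.Adj u v → Fintype.card V ≤ G.degree u + G.degree v)
    (hV : 2 ≤ Fintype.card V) {l : List V} (hl : l.Nodup) (hmem : ∀ x, x ∈ l)
    (h : G.cyclicGapCount l ≠ 0) :
    ∃ m, m.Perm l ∧ G.cyclicGapCount m < G.cyclicGapCount l := by
  obtain ⟨m, hm, hml, hgap⟩ := exists_perm_gap_getLast?_head?_ne_zero h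
  obtain ⟨u, v, hu, hv, huv⟩ := gap_ne_zero hgap
  have hnd : m.Nodup := hm.nodup_iff.2 hl
  have hmem' : ∀ x, x ∈ m := fun x ↦ hm.mem_iff.2 (hmem x)
  have hlen : m.length = Fintype.card V := hnd.length_eq_card_of_forall_mem hmem'
  have hdu : m.dropLast.countP (G.Adj u ·) = G.degree u := by
    rw [← countP_adj_eq_degree hnd hmem' u]
    conv_rhs => rw [← List.dropLast_append_getLast? u hu]
    simp
  have hdv : m.tail.countP (G.Adj v ·) = G.degree v := by
    rw [← countP_adj_eq_degree hnd hmem' v]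
    conv_rhs => rw [← List.cons_head?_tail hv]
    simp
  have hne : u ≠ v := by
    rintro rfl
    obtain ⟨t, rfl⟩ := List.head?_eq_some_iff.1 hv
    cases t with
    | nil => simp at hlen; omega
    | cons b t =>
      rw [List.getLast?_cons_cons] at hu
      exact (List.nodup_cons.1 hnd).1 (List.mem_of_getLast? hu)
  obtain ⟨A, B, a, b, rfl, ha, hb, hua, hvb⟩ :=
    m.exists_append_of_length_le_countP_add_countP (G.Adj u ·) (G.Adj v ·)
      (List.ne_nil_of_mem (hmem' u)) (by rw [hlen, hdu, hdv]; exact hOre u v hne huv)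
  refine ⟨A ++ B.reverse, ((List.reverse_perm B).append_left A).trans hm, ?_⟩
  have hA : A.head? = some v := by cases A <;> simp_all
  have hB : B.getLast? = some u := by
    rcases B.eq_nil_or_concat with rfl | ⟨B, c, rfl⟩ <;> simp_all
  rw [← hml]
  simp only [decide_eq_true_eq] at hua hvb
  simp [cyclicGapCount, gapCount_append, gapCount_reverse, ha, hb, hA, hB, gap_some_some,
    hua.symm, hvb.symm, huv]

lemma exists_cyclicGapCount_eq_zero
    (hOre : ∀ u v : V, u ≠ v → ¬ G.Adj u v → Fintype.card V ≤ G.degree u + G.degree v)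
    (hV : 2 ≤ Fintype.card V) :
    ∃ l : List V, l.Nodup ∧ (∀ x, x ∈ l) ∧ G.cyclicGapCount l = 0 := by
  have hne : {l : List V | l.Nodup ∧ ∀ x, x ∈ l}.Nonempty :=
    ⟨Finset.univ.toList, Finset.nodup_toList _, by simp⟩
  obtain ⟨l, ⟨hl, hmem⟩, hmin⟩ := exists_minimalFor_of_wellFoundedLT _ G.cyclicGapCount hne
  refine ⟨l, hl, hmem, by_contra fun h ↦ ?_⟩
  obtain ⟨m, hm, hlt⟩ := exists_cyclicGapCount_lt hOre hV hl hmem h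
  exact hlt.not_ge (hmin ⟨hm.nodup_iff.2 hl, fun x ↦ hm.mem_iff.2 (hmem x)⟩ hlt.le)

lemma isHamiltonian_of_cyclicGapCount_eq_zero (hV : 3 ≤ Fintype.card V) {l : List V}
    (hl : l.Nodup) (hmem : ∀ x, x ∈ l) (h : G.cyclicGapCount l = 0) : G.IsHamiltonian := by
  intro _
  have hlen : l.length = Fintype.card V := hl.length_eq_card_of_forall_mem hmem
  have hnil : l ≠ [] := by
    rintro rfl
    simp at hlen
    omega
  rw [cyclicGapCount, Nat.add_eq_zero_iff, List.getLast?_eq_some_getLast hnil,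
    List.head?_eq_some_head hnil] at h
  have hadj : G.Adj (l.getLast hnil) (l.head hnil) := by simpa [gap_some_some] using h.2
  let p := Walk.ofSupport l hnil (isChain_of_gapCount_eq_zero h.1)
  have hp : p.IsPath := .mk' (by simpa [p] using hl)
  have hpl : p.length = l.length - 1 := Walk.length_ofSupport ..
  refine ⟨_, .cons hadj p, Walk.isHamiltonianCycle_iff_isCycle_and_length_eq.2
    ⟨(Walk.cons_isCycle_iff p hadj).2 ⟨hp, fun hmem ↦ ?_⟩, ?_⟩⟩
  · have := hp.length_eq_one_of_mem_edges (Sym2.eq_swap ▸ hmem)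
    omega
  · rw [Walk.length_cons]
    omega

end SimpleGraph

/-- **Ore's theorem.** If `G` is a simple graph on `n ≥ 3` vertices such that
`d(u) + d(v) ≥ n` for every pair of distinct non-adjacent vertices `u` and `v`,
then `G` is Hamiltonian. -/
theorem ore_theorem {V : Type*} [Fintype V] [DecidableEq V]
    (G : SimpleGraph V) [DecidableRel G.Adj]
    (hn : 3 ≤ Fintype.card V)
    (hOre : ∀ u v : V, u ≠ v → ¬ G.Adj u v →
      Fintype.card V ≤ G.degree u + G.degree v) :
    G.IsHamiltonian := by
  have hV : 2 ≤ Fintype.card V := by omega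
  obtain ⟨l, hl, hmem, h⟩ := SimpleGraph.exists_cyclicGapCount_eq_zero hOre hV
  exact SimpleGraph.isHamiltonian_of_cyclicGapCount_eq_zero hn hl hmem h
end

section
/- Let G be a simple graph on n vertices, and let u, v be two distinct non-adjacent vertices of G with d_G(u) + d_G(v) ≥ n. Let G' be the graph obtained from G by adding the edge uv. Then G' is Hamiltonian if and only if G is Hamiltonian. -/
namespace SimpleGraph

variable {V : Type*} {G : SimpleGraph V} {u v : V}

namespace Walk

/-- A walk in `G ⊔ edge u v` that avoids the edge `uv` is a walk in `G`. -/
lemma mem_edgeSet_of_mem_edges_sup_edge {a b : V} {p : (G ⊔ edge u v).Walk a b}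
    (hp : s(u, v) ∉ p.edges) : ∀ e ∈ p.edges, e ∈ G.edgeSet := by
  intro e he
  have h := p.edges_subset_edgeSet he
  rw [edgeSet_sup] at h
  exact h.resolve_right fun h ↦ hp (edgeSet_edge_subset h ▸ he)

/-- An edge of a cycle at its base point is the first or the last edge of the cycle. -/
lemma IsCycle.snd_eq_or_penultimate_eq_of_mem_edges {p : G.Walk u u} (hp : p.IsCycle)
    (he : s(u, v) ∈ p.edges) : p.snd = v ∨ p.penultimate = v := by
  cases p with
  | nil => simp at he
  | cons h q =>
    have hq := ((cons_isCycle_iff q h).1 hp).1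
    rw [edges_cons, List.mem_cons] at he
    rcases he with he | he
    · left
      simpa using (Sym2.congr_right.1 he).symm
    · right
      have hnil : ¬ q.Nil := fun hn ↦ h.ne hn.eq.symm
      rw [penultimate_cons_of_not_nil _ _ hnil]
      exact (hq.eq_penultimate_of_mem_edges (Sym2.eq_swap ▸ he)).symm

variable [DecidableEq V]

/-- Deleting the added edge `uv` from a Hamiltonian cycle starting with it leaves a Hamiltonian
path between `u` and `v`. -/
lemma IsHamiltonianCycle.exists_isHamiltonian_of_snd_eq {p : (G ⊔ edge u v).Walk u u}
    (hp : p.IsHamiltonianCycle) (hv : p.snd = v) : ∃ q : G.Walk v u, q.IsHamiltonian := by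
  cases p with
  | nil => exact (hp.ne_nil rfl).elim
  | cons h q =>
    rw [snd_cons] at hv
    subst hv
    refine ⟨q.transfer G (mem_edgeSet_of_mem_edges_sup_edge
      ((cons_isCycle_iff q h).1 hp.isCycle).2), fun a ↦ ?_⟩
    rw [support_transfer]
    simpa using (isHamiltonianCycle_iff_isCycle_and_support_count_tail_eq_one.1 hp).2 a

variable [Fintype V]

/-- The reverse of a Hamiltonian cycle is a Hamiltonian cycle. -/
lemma IsHamiltonianCycle.reverse {p : G.Walk u u} (hp : p.IsHamiltonianCycle) :
    p.reverse.IsHamiltonianCycle := by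
  rw [isHamiltonianCycle_iff_isCycle_and_length_eq] at hp ⊢
  exact ⟨hp.1.reverse, by simpa using hp.2⟩

/-- If the ends of a Hamiltonian path are adjacent, respectively, to the second and the first of
two consecutive vertices of the path, then the graph is Hamiltonian. -/
lemma IsHamiltonian.isHamiltonian_of_adj_getVert {p : G.Walk u v} (hp : p.IsHamiltonian)
    (hV : 3 ≤ Fintype.card V) {i : ℕ} (hi : i < p.length)
    (hu : G.Adj u (p.getVert (i + 1))) (hv : G.Adj v (p.getVert i)) : G.IsHamiltonian := by
  intro _
  let q : G.Walk (p.getVert (i + 1)) u := (p.drop (i + 1)).append (cons hv (p.take i).reverse)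
  have hq : q.IsHamiltonian := by
    intro a
    have hsupp : q.support = p.support.drop (i + 1) ++ (p.support.take (i + 1)).reverse := by
      simp [q, support_append, support_reverse, support_take, drop_support_eq_support_drop_min,
        min_eq_left (Nat.succ_le_of_lt hi)]
    rw [hsupp, List.count_append, List.count_reverse, add_comm, ← List.count_append,
      List.take_append_drop, hp a]
  refine ⟨u, cons hu q, isHamiltonianCycle_iff_isCycle_and_length_eq.2
    ⟨(cons_isCycle_iff q hu).2 ⟨hq.isPath, fun he ↦ ?_⟩, ?_⟩⟩
  · have := hq.isPath.length_eq_one_of_mem_edges (Sym2.eq_swap ▸ he)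
    have := hq.length_eq
    lia
  · have := hq.length_eq
    rw [length_cons]
    lia

/-- **Crossing argument.** If the degrees of the ends of a Hamiltonian path sum to at least the
number of vertices, then the ends are adjacent, respectively, to the second and the first of two
consecutive vertices of the path. -/
lemma IsHamiltonian.exists_adj_getVert_of_card_le_degree_add_degree [DecidableRel G.Adj]
    {p : G.Walk u v} (hp : p.IsHamiltonian) (hdeg : Fintype.card V ≤ G.degree u + G.degree v) :
    ∃ i < p.length, G.Adj u (p.getVert (i + 1)) ∧ G.Adj v (p.getVert i) := by
  let A := {i ∈ Finset.range p.length | G.Adj u (p.getVert (i + 1))}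
  let B := {i ∈ Finset.range p.length | G.Adj v (p.getVert i)}
  have hA : G.degree u ≤ A.card := by
    refine (Finset.card_le_card fun w hw ↦ ?_).trans
      (Finset.card_image_le (s := A) (f := fun i ↦ p.getVert (i + 1)))
    rw [mem_neighborFinset] at hw
    obtain ⟨i, rfl, hi⟩ := mem_support_iff_exists_getVert.1 (hp.mem_support w)
    obtain _ | i := i
    · simp at hw
    · exact Finset.mem_image.2 ⟨i, by simp [A, hw]; lia, rfl⟩
  have hB : G.degree v ≤ B.card := by
    refine (Finset.card_le_card fun w hw ↦ ?_).trans
      (Finset.card_image_le (s := B) (f := p.getVert))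
    rw [mem_neighborFinset] at hw
    obtain ⟨i, rfl, hi⟩ := mem_support_iff_exists_getVert.1 (hp.mem_support w)
    obtain rfl | hi := hi.eq_or_lt
    · simp at hw
    · exact Finset.mem_image.2 ⟨i, by simp [B, hw, hi], rfl⟩
  have hcard : (Finset.range p.length).card < A.card + B.card := by
    have := hp.length_eq
    have : 0 < Fintype.card V := Fintype.card_pos_iff.2 ⟨u⟩
    rw [Finset.card_range]
    lia
  obtain ⟨i, hi⟩ := Finset.inter_nonempty_of_card_lt_card_add_card
    (Finset.filter_subset _ _) (Finset.filter_subset _ _) hcard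
  simp only [Finset.mem_inter, Finset.mem_filter, Finset.mem_range] at hi
  exact ⟨i, hi.1.1, hi.1.2, hi.2.2⟩

end Walk

end SimpleGraph

/-- **Bondy–Chvátal lemma.** If `u` and `v` are distinct non-adjacent vertices of a
simple graph `G` on `n` vertices with `d(u) + d(v) ≥ n`, then the graph `G'` obtained
from `G` by adding the edge `uv` is Hamiltonian if and only if `G` is Hamiltonian. -/
theorem bondy_chvatal {V : Type*} [Fintype V] [DecidableEq V]
    (G : SimpleGraph V) [DecidableRel G.Adj]
    (u v : V) (huv : u ≠ v) (hadj : ¬ G.Adj u v)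
    (hdeg : Fintype.card V ≤ G.degree u + G.degree v) :
    (G ⊔ SimpleGraph.edge u v).IsHamiltonian ↔ G.IsHamiltonian := by
  refine ⟨fun h hV ↦ ?_, fun h ↦ h.mono le_sup_left⟩
  have : Nontrivial V := ⟨u, v, huv⟩
  obtain ⟨p, hp⟩ := h.exists_isHamiltonianCycle u
  by_cases he : s(u, v) ∈ p.edges
  · obtain ⟨q, hq⟩ : ∃ q : G.Walk v u, q.IsHamiltonian := by
      rcases hp.isCycle.snd_eq_or_penultimate_eq_of_mem_edges he with hs | hs
      · exact hp.exists_isHamiltonian_of_snd_eq hs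
      · exact hp.reverse.exists_isHamiltonian_of_snd_eq (p.snd_reverse.trans hs)
    obtain ⟨i, hi, hvi, hui⟩ := hq.exists_adj_getVert_of_card_le_degree_add_degree
      (hdeg.trans_eq (add_comm _ _))
    exact hq.isHamiltonian_of_adj_getVert (hp.length_eq ▸ hp.three_le_length) hi hvi hui hV
  · have hG := SimpleGraph.Walk.mem_edgeSet_of_mem_edges_sup_edge he
    exact ⟨u, p.transfer G hG, SimpleGraph.Walk.isHamiltonianCycle_iff_isCycle_and_length_eq.2
      ⟨hp.isCycle.transfer hG, by rw [SimpleGraph.Walk.length_transfer, hp.length_eq]⟩⟩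
end

section
/- Let G be a 2-connected simple graph on n vertices with minimum degree δ satisfying δ ≥ (n+2)/3. Then G contains a Hamiltonian cycle, or G contains an independent set of size δ + 1. -/
/-- A graph is 2-connected if it has at least 3 vertices and remains connected after
deletion of any single vertex. -/
def TwoConnected {V : Type*} [Fintype V] (G : SimpleGraph V) : Prop :=
  3 ≤ Fintype.card V ∧ ∀ v : V, (G.induce ({v}ᶜ : Set V)).Connected

namespace SimpleGraph

variable {V : Type*} {G : SimpleGraph V}

/-- `l` lists the consecutive vertices of a walk of `G` from `p` to `q`. -/
def IsWalkList (G : SimpleGraph V) (p q : V) (l : List V) : Prop :=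
  l.IsChain G.Adj ∧ l.head? = some p ∧ l.getLast? = some q

theorem IsWalkList.singleton (p : V) : G.IsWalkList p p [p] := by
  simp [IsWalkList]

theorem IsWalkList.append {p q r s : V} {l l' : List V} (h : G.IsWalkList p q l)
    (h' : G.IsWalkList r s l') (hqr : G.Adj q r) : G.IsWalkList p s (l ++ l') := by
  obtain ⟨h1, h2, h3⟩ := h
  obtain ⟨h1', h2', h3'⟩ := h'
  refine ⟨List.isChain_append.2 ⟨h1, h1', ?_⟩, ?_, ?_⟩
  · simp_all
  · simp [List.head?_append, h2]
  · simp [List.getLast?_append, h3']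

theorem IsWalkList.reverse {p q : V} {l : List V} (h : G.IsWalkList p q l) :
    G.IsWalkList q p l.reverse := by
  obtain ⟨h1, h2, h3⟩ := h
  refine ⟨?_, by simpa using h3, by simpa using h2⟩
  rw [List.isChain_reverse]
  exact h1.imp fun _ _ h => h.symm

theorem IsWalkList.split {p q s t : V} {A B : List V}
    (h : G.IsWalkList p q (A ++ s :: t :: B)) :
    G.IsWalkList p s (A ++ [s]) ∧ G.Adj s t ∧ G.IsWalkList t q (t :: B) := by
  obtain ⟨h1, h2, h3⟩ := h
  rw [List.isChain_append_cons_cons] at h1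
  refine ⟨⟨h1.1, ?_, by simp⟩, h1.2.1, h1.2.2, by simp, ?_⟩
  · cases A <;> simp_all
  · simpa [List.getLast?_append, List.getLast?_cons] using h3

/-- Every cycle of `G`, listed by its vertices, has at most `c` vertices. -/
def CycleLengthLE (G : SimpleGraph V) (c : ℕ) : Prop :=
  ∀ l p q, G.IsWalkList p q l → G.Adj q p → l.Nodup → l.length ≤ c

/-- There is a path avoiding `C` with at least `k` vertices, whose first vertex is adjacent to `a`
and whose last vertex is adjacent to `b`. -/
def Bridged (G : SimpleGraph V) (C : List V) (k : ℕ) (a b : V) : Prop :=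
  ∃ p q P, G.IsWalkList p q P ∧ G.Adj a p ∧ G.Adj q b ∧ P.Nodup ∧ (∀ z ∈ P, z ∉ C) ∧ k ≤ P.length

theorem Bridged.symm {C : List V} {k : ℕ} {a b : V} (h : G.Bridged C k a b) :
    G.Bridged C k b a := by
  obtain ⟨p, q, P, h1, h2, h3, h4, h5, h6⟩ := h
  exact ⟨q, p, P.reverse, h1.reverse, h3.symm, h2.symm, by simpa, by simpa, by simpa⟩

theorem countP_add_countP_add_countP_le (p q r : V → Bool) (L : List V) : ∀ ρ : Bool,
    (∀ t B, L = t :: B → ¬(ρ ∧ q t)) → (∀ s t B, L = s :: t :: B → ¬(ρ ∧ p t)) →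
    (∀ A s t B, L = A ++ s :: t :: B → ¬(p t ∧ q s) ∧ ¬(r s ∧ q t)) →
    (∀ A s m t B, L = A ++ s :: m :: t :: B → ¬(r s ∧ p t)) →
    (if ρ then 1 else 0) + L.tail.countP p + L.countP q + L.countP r ≤ L.length + 1 := by
  induction L with
  | nil => intro ρ; cases ρ <;> simp
  | cons s L ih =>
    intro ρ h1 h2 h3 h4
    have := ih (r s) (fun t B e => by have := h3 [] s t B (by simp [e]); tauto)
      (fun m t B e => h4 [] s m t B (by simp [e]))
      (fun A s' t B e => h3 (s :: A) s' t B (by simp [e]))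
      (fun A s' m t B e => h4 (s :: A) s' m t B (by simp [e]))
    have h1' := h1 s L rfl
    cases L with
    | nil => simp [List.countP_cons]; grind
    | cons t B =>
      have h2' := h2 s t B rfl
      have h3' := h3 [] s t B rfl
      simp [List.countP_cons] at this ⊢
      grind

/-- The cycle `S₁ ++ S₂`, of maximum length, is cut into two segments: `S₁` from `x` to `b` and
`S₂` from `y` to `a`. -/
structure CutCycle (G : SimpleGraph V) (C S₁ S₂ : List V) (x b y a : V) : Prop where
  left : G.IsWalkList x b S₁
  right : G.IsWalkList y a S₂
  adj_left : G.Adj a x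
  adj_right : G.Adj b y
  nodup : (S₁ ++ S₂).Nodup
  le : G.CycleLengthLE (S₁ ++ S₂).length
  mem : ∀ z, z ∈ C ↔ z ∈ S₁ ++ S₂

namespace CutCycle

variable {C S₁ S₂ : List V} {x b y a : V}

theorem symm (h : G.CutCycle C S₁ S₂ x b y a) : G.CutCycle C S₂ S₁ y a x b where
  left := h.right
  right := h.left
  adj_left := h.adj_right
  adj_right := h.adj_left
  nodup := List.nodup_append_comm.1 h.nodup
  le := by have := h.le; rwa [List.length_append, add_comm, ← List.length_append] at this
  mem z := by rw [h.mem]; simp [or_comm]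

theorem not_bridged (h : G.CutCycle C S₁ S₂ x b y a) : ¬ G.Bridged C 1 a x := by
  rintro ⟨p, q, P, h1, h2, h3, h4, h5, h6⟩
  have := h.le _ _ _ ((h.left.append h.right h.adj_right).append h1 h2) h3
    (by have := h.nodup; have := h.mem; simp only [List.nodup_append] at *; grind)
  simp only [List.length_append] at this; omega

theorem not_adj_and_adj_of_notMem (h : G.CutCycle C S₁ S₂ x b y a) (hab : G.Bridged C 1 a b)
    {w : V} (hw : w ∉ C) : ¬ (G.Adj x w ∧ G.Adj y w) := by
  rintro ⟨hx, hy⟩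
  obtain ⟨p, q, P, h1, h2, h3, h4, h5, h6⟩ := hab
  by_cases hwP : w ∈ P
  · obtain ⟨A, B, rfl⟩ := List.append_of_mem hwP
    refine h.not_bridged ⟨p, w, A ++ [w], ?_, h2, hx.symm, ?_, ?_, by simp⟩
    · cases B with
      | nil => exact ⟨h1.1, h1.2.1, by simp⟩
      | cons t B => exact h1.split.1
    · simp only [List.nodup_append] at *; grind
    · grind
  · have := h.le _ _ _ (((h.left.append h1.reverse h3.symm).append h.right.reverse
        h2.symm).append (.singleton w) hy) hx.symm
      (by have := h.nodup; have := h.mem; simp only [List.nodup_append] at *; grind)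
    simp only [List.length_append, List.length_reverse, List.length_cons] at this; omega

theorem not_adj (h : G.CutCycle C S₁ S₂ x b y a) (hab : G.Bridged C 1 a b) : ¬ G.Adj x y := by
  intro hxy
  obtain ⟨p, q, P, h1, h2, h3, h4, h5, h6⟩ := hab
  have := h.le _ _ _ ((h.left.reverse.append h.right hxy).append h1 h2) h3
    (by have := h.nodup; have := h.mem; simp only [List.nodup_append] at *; grind)
  simp only [List.length_append, List.length_reverse] at this; omega

theorem not_adj_and_adj (h : G.CutCycle C S₁ S₂ x b y a) (hab : G.Bridged C 1 a b)
    {A B : List V} {s t : V} (e : S₁ = A ++ s :: t :: B) : ¬ (G.Adj x t ∧ G.Adj y s) := by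
  rintro ⟨hx, hy⟩
  obtain ⟨p, q, P, h1, h2, h3, h4, h5, h6⟩ := hab
  have hn := h.nodup
  have hm := h.mem
  have hl := h.left
  have hle := h.le
  rw [e] at hl hn hm hle
  obtain ⟨l1, l2, l3⟩ := hl.split
  have := hle _ _ _ (((l1.append h.right hy.symm).append h1 h2).append l3.reverse h3) hx.symm
    (by simp only [List.nodup_append] at *; grind)
  simp only [List.length_append, List.length_reverse, List.length_cons] at this; omega

theorem not_adj_of_bridged_right (h : G.CutCycle C S₁ S₂ x b y a)
    {A B : List V} {s t : V} (e : S₁ = A ++ s :: t :: B) (hs : G.Bridged C 1 s b) :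
    ¬ G.Adj y t := by
  intro hy
  obtain ⟨p, q, P, h1, h2, h3, h4, h5, h6⟩ := hs
  have hn := h.nodup
  have hm := h.mem
  have hl := h.left
  have hle := h.le
  rw [e] at hl hn hm hle
  obtain ⟨l1, l2, l3⟩ := hl.split
  have := hle _ _ _ (((l1.append h1 h2).append l3.reverse h3).append h.right hy.symm) h.adj_left
    (by simp only [List.nodup_append] at *; grind)
  simp only [List.length_append, List.length_reverse, List.length_cons] at this; omega

theorem not_adj_of_bridged_left (h : G.CutCycle C S₁ S₂ x b y a)
    {A B : List V} {s m t : V} (e : S₁ = A ++ s :: m :: t :: B) (hs : G.Bridged C 2 s a) :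
    ¬ G.Adj x t := by
  intro hx
  obtain ⟨p, q, P, h1, h2, h3, h4, h5, h6⟩ := hs
  have hn := h.nodup
  have hm := h.mem
  have hl := h.left
  have hle := h.le
  rw [e] at hl hn hm hle
  obtain ⟨l1, -, -⟩ := hl.split
  obtain ⟨-, -, l3⟩ := IsWalkList.split (A := A ++ [s]) (by simpa using hl)
  have := hle _ _ _ (((l1.append h1 h2).append h.right.reverse h3).append l3.reverse
    h.adj_right.symm) hx.symm
    (by simp only [List.nodup_append, List.nodup_cons, List.nodup_reverse, List.mem_append,
      List.mem_reverse, List.mem_cons] at *; grind)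
  simp only [List.length_append, List.length_reverse, List.length_cons] at this; omega

theorem countP_left_le [DecidableRel G.Adj] (h : G.CutCycle C S₁ S₂ x b y a)
    (hab : G.Bridged C 1 a b) {u : V}
    (hu : ∀ v ∈ C, G.Adj u v → G.Bridged C 1 v b ∧ G.Bridged C 2 v a) :
    S₁.countP (G.Adj x ·) + S₁.countP (G.Adj y ·) + S₁.countP (G.Adj u ·) ≤ S₁.length + 1 := by
  have key := countP_add_countP_add_countP_le (G.Adj x ·) (G.Adj y ·) (G.Adj u ·) S₁ false
    (by simp) (by simp)
    (fun A s t B e => ⟨by simpa using h.not_adj_and_adj hab e, fun hh => by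
      simp only [decide_eq_true_eq] at hh
      exact h.not_adj_of_bridged_right e (hu s ((h.mem s).2 (by simp [e])) hh.1).1 hh.2⟩)
    (fun A s m t B e hh => by
      simp only [decide_eq_true_eq] at hh
      exact h.not_adj_of_bridged_left e (hu s ((h.mem s).2 (by simp [e])) hh.1).2 hh.2)
  obtain ⟨-, hd, -⟩ := h.left
  cases S₁ with
  | nil => simp at hd
  | cons z L =>
    obtain rfl : z = x := by simpa using hd
    simpa [List.countP_cons] using key

end CutCycle

variable {C : List V}

theorem Bridged.mono {k m : ℕ} {a b : V} (hkm : k ≤ m) (h : G.Bridged C m a b) :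
    G.Bridged C k a b := by
  obtain ⟨p, q, P, h1, h2, h3, h4, h5, h6⟩ := h
  exact ⟨p, q, P, h1, h2, h3, h4, h5, hkm.trans h6⟩

theorem degree_eq_countP_add_card [Fintype V] [DecidableEq V] [DecidableRel G.Adj]
    (hC : C.Nodup) (x : V) :
    G.degree x = C.countP (G.Adj x ·) + (Finset.univ.filter fun w => G.Adj x w ∧ w ∉ C).card := by
  have h1 : C.countP (G.Adj x ·) = (Finset.univ.filter fun w => G.Adj x w ∧ w ∈ C).card := by
    rw [List.countP_eq_length_filter, ← List.toFinset_card_of_nodup (hC.filter _)]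
    congr 1
    ext w
    simp [and_comm]
  have h2 := Finset.card_filter_add_card_filter_not (s := G.neighborFinset x) (· ∈ C)
  rw [← card_neighborFinset_eq_degree, ← h2, h1]
  congr 2 <;> ext w <;> simp

theorem CutCycle.degree_add_degree_add_degree_le [Fintype V] [DecidableEq V] [DecidableRel G.Adj]
    {S₁ S₂ : List V} {x b y a u : V} (h : G.CutCycle C S₁ S₂ x b y a)
    (hab : G.Bridged C 1 a b) (hu : u ∉ C)
    (hv : ∀ v ∈ C, G.Adj u v → G.Bridged C 2 v b ∧ G.Bridged C 2 v a)
    (hx : ∀ w ∉ C, w = u ∨ G.Adj u w → ¬ G.Adj x w)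
    (hy : ∀ w ∉ C, w = u ∨ G.Adj u w → ¬ G.Adj y w) :
    G.degree x + G.degree y + G.degree u ≤ Fintype.card V + 1 := by
  have c1 := h.countP_left_le hab fun v hvC huv =>
    ⟨(hv v hvC huv).1.mono (by simp), (hv v hvC huv).2⟩
  have c2 := h.symm.countP_left_le hab.symm fun v hvC huv =>
    ⟨(hv v hvC huv).2.mono (by simp), (hv v hvC huv).1⟩
  have hm : ∀ z, z ∈ S₁ ++ S₂ ↔ z ∈ C := fun z => (h.mem z).symm
  have dx := degree_eq_countP_add_card (G := G) h.nodup x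
  have dy := degree_eq_countP_add_card (G := G) h.nodup y
  have du := degree_eq_countP_add_card (G := G) h.nodup u
  simp only [List.countP_append, hm] at dx dy du
  set X := Finset.univ.filter fun w => G.Adj x w ∧ w ∉ C with hX
  set Y := Finset.univ.filter fun w => G.Adj y w ∧ w ∉ C with hY
  set U := Finset.univ.filter fun w => G.Adj u w ∧ w ∉ C with hU
  have hcard : S₁.length + S₂.length + (X.card + Y.card + (U.card + 1)) ≤ Fintype.card V := by
    rw [← List.length_append, ← List.toFinset_card_of_nodup h.nodup,
      ← Finset.card_insert_of_notMem (s := U) (a := u) (by simp [hU]),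
      ← Finset.card_union_of_disjoint, ← Finset.card_union_of_disjoint,
      ← Finset.card_union_of_disjoint]
    · exact Finset.card_le_univ _
    · rw [Finset.disjoint_left]
      intro w hw
      rw [List.mem_toFinset, hm] at hw
      simp only [Finset.mem_union, Finset.mem_insert, hX, hY, hU, Finset.mem_filter]
      grind
    · rw [Finset.disjoint_left]
      intro w hw
      simp only [Finset.mem_union, Finset.mem_insert, hX, hY, hU, Finset.mem_filter,
        Finset.mem_univ, true_and] at hw ⊢
      grind
    · rw [Finset.disjoint_left]
      intro w hw hw'
      simp only [hX, hY, Finset.mem_filter, Finset.mem_univ, true_and] at hw hw'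
      exact h.not_adj_and_adj_of_notMem hab hw.2 ⟨hw.1, hw'.1⟩
  omega

theorem IsWalkList.exists_isRotated_append_singleton [DecidableEq V] {p q a : V}
    (h : G.IsWalkList p q C) (hqp : G.Adj q p) (hC : C.Nodup) (ha : a ∈ C) :
    ∃ L, G.IsWalkList (C.formPerm a) a (L ++ [a]) ∧ G.Adj a (C.formPerm a) ∧ C ~r (L ++ [a]) := by
  obtain ⟨x, L, h1, h2, h3⟩ :
      ∃ x L, G.IsWalkList x a (L ++ [a]) ∧ G.Adj a x ∧ C ~r (L ++ [a]) := by
    obtain ⟨A, B, rfl⟩ := List.append_of_mem ha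
    cases B with
    | nil =>
      obtain rfl : a = q := by simpa using h.2.2
      exact ⟨p, A, h, hqp, .refl _⟩
    | cons t B =>
      obtain ⟨l1, l2, l3⟩ := h.split
      refine ⟨t, t :: B ++ A, by simpa using l3.append l1 hqp, l2, ?_⟩
      have : (A ++ [a] ++ t :: B) ~r (t :: B ++ (A ++ [a])) := List.isRotated_append
      simpa using this
  have : C.formPerm a = x := by
    rw [List.formPerm_eq_of_isRotated hC h3]
    obtain ⟨-, e, -⟩ := h1
    generalize hM : L ++ [a] = M at e
    cases M with
    | nil => simp at e
    | cons z M =>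
      obtain rfl : z = x := by simpa using e
      have := List.formPerm_apply_getLast z M
      simpa only [← hM, List.getLast_append_singleton] using this
  exact ⟨L, this ▸ h1, this ▸ h2, h3⟩

theorem IsWalkList.exists_cutCycle [DecidableEq V] {p q a b : V} (h : G.IsWalkList p q C)
    (hqp : G.Adj q p) (hC : C.Nodup) (hmax : G.CycleLengthLE C.length) (ha : a ∈ C) (hb : b ∈ C)
    (hab : a ≠ b) :
    ∃ S₁ S₂, G.CutCycle C S₁ S₂ (C.formPerm a) b (C.formPerm b) a := by
  obtain ⟨L, h1, h2, h3⟩ := h.exists_isRotated_append_singleton hqp hC ha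
  have hbL : b ∈ L := by
    have := h3.mem_iff.1 hb
    simpa [hab.symm] using this
  obtain ⟨D, E, rfl⟩ := List.append_of_mem hbL
  obtain ⟨y, F, hF⟩ : ∃ y F, E ++ [a] = y :: F := by cases E <;> simp
  have e : D ++ b :: E ++ [a] = D ++ b :: y :: F := by simp [hF]
  have hn := h3.nodup_iff.1 hC
  rw [e] at h1 h3 hn
  have hy : C.formPerm b = y := by
    rw [List.formPerm_eq_of_isRotated hC h3]
    have := List.formPerm_apply_lt_getElem _ hn D.length (by simp)
    simpa using this
  obtain ⟨l1, l2, l3⟩ := h1.split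
  rw [hy]
  have e' : (D ++ [b]) ++ (y :: F) = D ++ b :: y :: F := by simp
  exact ⟨D ++ [b], y :: F, l1, l3, h2, l2, e' ▸ hn, by rw [e', ← h3.perm.length_eq]; exact hmax,
    fun z => by rw [e']; exact h3.mem_iff⟩

theorem IsWalkList.not_adj_formPerm [DecidableEq V] {p q a v : V} (h : G.IsWalkList p q C)
    (hqp : G.Adj q p) (hC : C.Nodup) (hmax : G.CycleLengthLE C.length) (ha : a ∈ C) (hv : v ∉ C)
    (hva : G.Adj v a) : ¬ G.Adj v (C.formPerm a) := by
  intro hvx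
  obtain ⟨L, h1, h2, h3⟩ := h.exists_isRotated_append_singleton hqp hC ha
  have := hmax _ _ _ (h1.append (.singleton v) hva.symm) hvx (by
    refine List.Nodup.append (h3.nodup_iff.1 hC) (by simp) ?_
    rw [List.disjoint_singleton]
    exact fun hh => hv (h3.mem_iff.2 hh))
  rw [h3.perm.length_eq] at this
  simp at this

theorem IsWalkList.exists_isIndepSet [Fintype V] [DecidableEq V] [DecidableRel G.Adj] {p q v : V}
    (h : G.IsWalkList p q C) (hqp : G.Adj q p) (hC : C.Nodup) (hmax : G.CycleLengthLE C.length)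
    (hv : v ∉ C) (hvC : ∀ w, G.Adj v w → w ∈ C) :
    ∃ s : Finset V, s.card = G.degree v + 1 ∧ ∀ u ∈ s, ∀ w ∈ s, u ≠ w → ¬ G.Adj u w := by
  have key : ∀ a, G.Adj v a → ¬ G.Adj v (C.formPerm a) := fun a ha =>
    h.not_adj_formPerm hqp hC hmax (hvC a ha) hv ha
  have key2 : ∀ a b, a ≠ b → G.Adj v a → G.Adj v b →
      ¬ G.Adj (C.formPerm a) (C.formPerm b) := by
    intro a b hab ha hb
    obtain ⟨S₁, S₂, hS⟩ := h.exists_cutCycle hqp hC hmax (hvC a ha) (hvC b hb) hab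
    exact hS.not_adj ⟨v, v, [v], .singleton v, ha.symm, hb, by simp, by simpa, by simp⟩
  refine ⟨insert v ((G.neighborFinset v).image C.formPerm), ?_, ?_⟩
  · rw [Finset.card_insert_of_notMem, Finset.card_image_of_injective _ C.formPerm.injective,
      card_neighborFinset_eq_degree]
    simp only [Finset.mem_image, mem_neighborFinset, not_exists, not_and]
    intro a ha e
    exact hv (e ▸ List.formPerm_apply_mem_of_mem (hvC a ha))
  · simp only [Finset.mem_insert, Finset.mem_image, mem_neighborFinset]
    rintro _ (rfl | ⟨a, ha, rfl⟩) _ (rfl | ⟨b, hb, rfl⟩) hne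
    · exact absurd rfl hne
    · exact key b hb
    · exact fun hh => key a ha hh.symm
    · exact key2 a b (fun e => hne (e ▸ rfl)) ha hb

/-- The graph on the vertices of `G` whose edges are the edges of `G` avoiding `C`. -/
def avoiding (G : SimpleGraph V) (C : List V) : SimpleGraph V where
  Adj p q := G.Adj p q ∧ p ∉ C ∧ q ∉ C
  symm := ⟨fun _ _ h => ⟨h.1.symm, h.2.2, h.2.1⟩⟩
  loopless := ⟨fun _ h => h.1.ne rfl⟩

theorem notMem_of_avoiding_reachable {w z : V} (hw : w ∉ C) (h : (G.avoiding C).Reachable w z) :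
    z ∉ C := by
  rw [reachable_iff_reflTransGen] at h
  cases h with
  | refl => exact hw
  | tail _ h => exact h.2.2

theorem bridged_of_avoiding_reachable {k l a b : V} (hk : k ∉ C)
    (h : (G.avoiding C).Reachable k l) (hak : G.Adj a k) (hlb : G.Adj l b) :
    G.Bridged C 1 a b ∧ (k ≠ l → G.Bridged C 2 a b) := by
  obtain ⟨P, hP⟩ := h.exists_isPath
  have hw : G.IsWalkList k l P.support := by
    refine ⟨P.isChain_adj_support.imp fun _ _ h => h.1, ?_, ?_⟩
    · rw [List.head?_eq_some_head P.support_ne_nil, P.head_support]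
    · rw [List.getLast?_eq_some_getLast P.support_ne_nil, P.getLast_support]
  have hC : ∀ z ∈ P.support, z ∉ C := fun z hz => by
    classical exact notMem_of_avoiding_reachable hk (P.takeUntil z hz).reachable
  refine ⟨⟨k, l, _, hw, hak, hlb, hP.support_nodup, hC, by simp⟩,
    fun hne => ⟨k, l, _, hw, hak, hlb, hP.support_nodup, hC, ?_⟩⟩
  rw [P.length_support]
  have : P.length ≠ 0 := fun h0 => hne (Walk.eq_of_length_eq_zero h0)
  omega

theorem exists_avoiding_reachable_adj {w a c : V} (hw : w ∉ C) (ha : a ∈ C) (hc : c ∈ C)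
    (hca : c ≠ a) (hconn : (G.induce ({a}ᶜ : Set V)).Connected) :
    ∃ b ∈ C, b ≠ a ∧ ∃ k, (G.avoiding C).Reachable w k ∧ G.Adj k b := by
  by_contra! hno
  have hwa : w ≠ a := fun e => hw (e ▸ ha)
  have hr := hconn.preconnected ⟨w, hwa⟩ ⟨c, hca⟩
  have key : ∀ z : ({a}ᶜ : Set V), (G.induce ({a}ᶜ : Set V)).Reachable ⟨w, hwa⟩ z →
      (G.avoiding C).Reachable w z := by
    intro z hz
    rw [reachable_iff_reflTransGen] at hz
    induction hz with
    | refl => exact .refl _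
    | @tail s t _ hst ih =>
      have hst' : G.Adj s t := hst
      have ht : (t : V) ∉ C := fun ht => hno t ht t.2 s ih hst'
      exact ih.trans (Adj.reachable ⟨hst', notMem_of_avoiding_reachable hw ih, ht⟩)
  exact notMem_of_avoiding_reachable hw (key _ hr) hc

theorem IsWalkList.exists_walk {p q : V} {l : List V} (h : G.IsWalkList p q l) :
    ∃ W : G.Walk p q, W.support = l := by
  induction l generalizing p with
  | nil => simp [IsWalkList] at h
  | cons s l ih =>
    obtain rfl : s = p := by simpa using h.2.1
    cases l with
    | nil =>
      obtain rfl : s = q := by simpa using h.2.2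
      exact ⟨.nil, rfl⟩
    | cons t B =>
      obtain ⟨-, l2, l3⟩ := IsWalkList.split (A := []) h
      obtain ⟨W, hW⟩ := ih l3
      exact ⟨.cons l2 W, by simp [hW]⟩

theorem IsWalkList.isHamiltonian [Fintype V] [DecidableEq V] {p q : V} (h : G.IsWalkList p q C)
    (hqp : G.Adj q p) (hC : C.Nodup) (hV : 3 ≤ Fintype.card V) (hall : ∀ v, v ∈ C) :
    G.IsHamiltonian := by
  intro _
  obtain ⟨W, rfl⟩ := h.exists_walk
  have hP : W.IsPath := .mk' hC
  have hH : W.IsHamiltonian := hP.isHamiltonian_iff.2 hall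
  refine ⟨q, .cons hqp W, ?_⟩
  rw [Walk.isHamiltonianCycle_iff_isCycle_and_length_eq, Walk.cons_isCycle_iff]
  refine ⟨⟨hP, fun he => ?_⟩, ?_⟩
  · have := hP.length_eq_one_of_mem_edges (Sym2.eq_swap ▸ he)
    have := hH.length_eq
    omega
  · rw [Walk.length_cons, hH.length_eq]
    omega

theorem Adj.exists_longest_cycle [Fintype V] {v w : V} (h : G.Adj v w) :
    ∃ C p q, G.IsWalkList p q C ∧ G.Adj q p ∧ C.Nodup ∧ 2 ≤ C.length ∧
      G.CycleLengthLE C.length := by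
  classical
  let P : ℕ → Prop := fun n => ∃ C p q, G.IsWalkList p q C ∧ G.Adj q p ∧ C.Nodup ∧ C.length = n
  have h2 : P 2 := ⟨[v, w], v, w, by simp [IsWalkList, h], h.symm, by simp [h.ne], rfl⟩
  have hle : ∀ n, P n → n ≤ Fintype.card V := by
    rintro n ⟨C, p, q, -, -, hC, rfl⟩
    exact hC.length_le_card
  obtain ⟨C, p, q, h1, h3, h4, h5⟩ := Nat.findGreatest_spec (hle 2 h2) h2
  refine ⟨C, p, q, h1, h3, h4, h5 ▸ Nat.le_findGreatest (hle 2 h2) h2, ?_⟩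
  intro l p' q' hl hl' hn
  rw [h5]
  have hPl : P l.length := ⟨l, p', q', hl, hl', hn, rfl⟩
  exact Nat.le_findGreatest (hle _ hPl) hPl

theorem IsWalkList.not_of_avoiding_reachable [Fintype V] [DecidableEq V] [DecidableRel G.Adj]
    {p q a b k l u : V} (h : G.IsWalkList p q C) (hqp : G.Adj q p) (hC : C.Nodup)
    (hmax : G.CycleLengthLE C.length) (hdelta : Fintype.card V + 2 ≤ 3 * G.minDegree)
    (ha : a ∈ C) (hb : b ∈ C) (hab : a ≠ b) (hu : u ∉ C) (hk : (G.avoiding C).Reachable u k)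
    (hl : (G.avoiding C).Reachable u l) (hku : k ≠ u) (hlu : l ≠ u) (hak : G.Adj a k)
    (hbl : G.Adj b l) : False := by
  obtain ⟨S₁, S₂, hS⟩ := h.exists_cutCycle hqp hC hmax ha hb hab
  have hkC := notMem_of_avoiding_reachable hu hk
  have hlC := notMem_of_avoiding_reachable hu hl
  have hmem : ∀ w ∉ C, w = u ∨ G.Adj u w → (G.avoiding C).Reachable u w := by
    rintro w hw (rfl | huw)
    · exact .refl _
    · exact Adj.reachable ⟨huw, hu, hw⟩
  have := hS.degree_add_degree_add_degree_le
    (bridged_of_avoiding_reachable hkC (hk.symm.trans hl) hak hbl.symm).1 hu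
    (fun v _ huv => ⟨(bridged_of_avoiding_reachable hu hl huv.symm hbl.symm).2 hlu.symm,
      (bridged_of_avoiding_reachable hu hk huv.symm hak.symm).2 hku.symm⟩)
    (fun w hw huw hx => hS.not_bridged
      (bridged_of_avoiding_reachable hkC (hk.symm.trans (hmem w hw huw)) hak hx.symm).1)
    (fun w hw huw hy => hS.symm.not_bridged
      (bridged_of_avoiding_reachable hlC (hl.symm.trans (hmem w hw huw)) hbl hy.symm).1)
  have := G.minDegree_le_degree (C.formPerm a)
  have := G.minDegree_le_degree (C.formPerm b)
  have := G.minDegree_le_degree u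
  omega

theorem IsWalkList.three_le_minDegree [Fintype V] [DecidableEq V] [DecidableRel G.Adj]
    {p q a b k l : V} (h : G.IsWalkList p q C) (hqp : G.Adj q p) (hC : C.Nodup)
    (hmax : G.CycleLengthLE C.length) (hdelta : Fintype.card V + 2 ≤ 3 * G.minDegree)
    (ha : a ∈ C) (hb : b ∈ C) (hab : a ≠ b) (hk : k ∉ C) (hkl : (G.avoiding C).Reachable k l)
    (hne : k ≠ l) (hak : G.Adj a k) (hbl : G.Adj b l) : 3 ≤ G.minDegree := by
  obtain ⟨S₁, S₂, hS⟩ := h.exists_cutCycle hqp hC hmax ha hb hab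
  have hlC := notMem_of_avoiding_reachable hk hkl
  have hxb : C.formPerm a ≠ b := fun e => hS.not_bridged
    (e ▸ (bridged_of_avoiding_reachable hk hkl hak hbl.symm).1)
  have hxa : C.formPerm a ≠ a := fun e => hS.adj_left.ne e.symm
  have hx : C.formPerm a ∈ C := List.formPerm_apply_mem_of_mem ha
  have hcard : ({k, l, a, b, C.formPerm a} : Finset V).card = 5 := by
    repeat rw [Finset.card_insert_of_notMem]
    · simp
    all_goals simp only [Finset.mem_insert, Finset.mem_singleton]; grind
  have := Finset.card_le_univ ({k, l, a, b, C.formPerm a} : Finset V)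
  omega

end SimpleGraph

/-- **Nash-Williams.** A 2-connected graph on `n` vertices with minimum degree
`δ ≥ (n+2)/3` contains a Hamiltonian cycle or an independent set of size `δ + 1`. -/
theorem nash_williams {V : Type*} [Fintype V] [DecidableEq V]
    (G : SimpleGraph V) [DecidableRel G.Adj]
    (h2conn : TwoConnected G)
    (hdelta : Fintype.card V + 2 ≤ 3 * G.minDegree) :
    G.IsHamiltonian ∨
      ∃ s : Finset V, s.card = G.minDegree + 1 ∧
        ∀ u ∈ s, ∀ v ∈ s, u ≠ v → ¬ G.Adj u v := by
  obtain ⟨hV, hconn⟩ := h2conn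
  obtain ⟨v₀⟩ : Nonempty V := Fintype.card_pos_iff.1 (by omega)
  obtain ⟨v₁, hv⟩ : ∃ v₁, G.Adj v₀ v₁ := by
    rw [← G.degree_pos_iff_exists_adj]
    have := G.minDegree_le_degree v₀
    omega
  obtain ⟨C, p, q, hC, hqp, hn, h2, hmax⟩ := hv.exists_longest_cycle
  by_cases hall : ∀ v, v ∈ C
  · exact .inl (hC.isHamiltonian hqp hn hV hall)
  push Not at hall
  obtain ⟨w, hw⟩ := hall
  right
  by_cases hiso : ∃ v, v ∉ C ∧ ∀ z, G.Adj v z → z ∈ C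
  · obtain ⟨v, hvC, hvz⟩ := hiso
    obtain ⟨s, hs, hind⟩ := hC.exists_isIndepSet hqp hn hmax hvC hvz
    obtain ⟨t, hts, ht⟩ := Finset.exists_subset_card_eq
      (s := s) (n := G.minDegree + 1) (by have := G.minDegree_le_degree v; omega)
    exact ⟨t, ht, fun u hu v hv => hind u (hts hu) v (hts hv)⟩
  exfalso
  push Not at hiso
  have hattach : ∀ a ∈ C, ∃ b ∈ C, b ≠ a ∧ ∃ k, (G.avoiding C).Reachable w k ∧ G.Adj k b := by
    intro a ha
    obtain ⟨c, hc, hca⟩ : ∃ c ∈ C, c ≠ a := by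
      by_contra! hno
      have : C ⊆ [a] := fun c hc => by simp [hno c hc]
      have := (hn.subperm this).length_le
      simp at this
      omega
    exact SimpleGraph.exists_avoiding_reachable_adj hw ha hc hca (hconn a)
  have hpC : p ∈ C := List.mem_of_head? hC.2.1
  obtain ⟨a, ha, -, k, hk, hka⟩ := hattach p hpC
  obtain ⟨b, hb, hba, l, hl, hlb⟩ := hattach a ha
  have hkC := SimpleGraph.notMem_of_avoiding_reachable hw hk
  have hkl := hk.symm.trans hl
  by_cases hex : ∃ u, (G.avoiding C).Reachable k u ∧ k ≠ u ∧ l ≠ u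
  · obtain ⟨u, hku, hne, hne'⟩ := hex
    exact hC.not_of_avoiding_reachable hqp hn hmax hdelta ha hb hba.symm
      (SimpleGraph.notMem_of_avoiding_reachable hkC hku) hku.symm (hku.symm.trans hkl) hne hne' hka.symm
      hlb.symm
  push Not at hex
  obtain ⟨z, hkz, hzC⟩ := hiso k hkC
  have hkz' : (G.avoiding C).Reachable k z := SimpleGraph.Adj.reachable ⟨hkz, hkC, hzC⟩
  obtain rfl := hex z hkz' hkz.ne
  have h3 := hC.three_le_minDegree hqp hn hmax hdelta ha hb hba.symm hkC hkl hkz.ne hka.symm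
    hlb.symm
  have hcard : 1 < ((G.neighborFinset k).erase l).card := by
    have := Finset.pred_card_le_card_erase (s := G.neighborFinset k) (a := l)
    rw [SimpleGraph.card_neighborFinset_eq_degree] at this
    have := G.minDegree_le_degree k
    omega
  obtain ⟨c, hc, d, hd, hcd⟩ := Finset.one_lt_card.1 hcard
  have hmem : ∀ c ∈ (G.neighborFinset k).erase l, c ∈ C ∧ G.Adj c k := by
    intro c hc
    rw [Finset.mem_erase, SimpleGraph.mem_neighborFinset] at hc
    refine ⟨by_contra fun hcC => ?_, hc.2.symm⟩
    exact hc.1 (hex c (SimpleGraph.Adj.reachable ⟨hc.2, hkC, hcC⟩) hc.2.ne).symm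
  exact hC.not_of_avoiding_reachable hqp hn hmax hdelta (hmem c hc).1 (hmem d hd).1 hcd hzC
    hkl.symm hkl.symm hkz.ne hkz.ne (hmem c hc).2 (hmem d hd).2
end

section
/- Let G be a simple graph whose vertex set is partitioned into a nonempty set S and a set C' that induces a clique in G. If there exists a path cover of S in G having C'-endpoints, then G is Hamiltonian. -/
namespace SimpleGraph

variable {V : Type*} {G : SimpleGraph V} {C : Set V}

/-- `G.IsSpannedFrom C X` says that `X` is empty or the vertex set of a path of `G` whose two
endpoints lie in `C`. -/
def IsSpannedFrom (G : SimpleGraph V) (C X : Set V) : Prop :=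
  X = ∅ ∨ ∃ u ∈ C, ∃ v ∈ C, ∃ p : G.Walk u v, p.IsPath ∧ ∀ x, x ∈ p.support ↔ x ∈ X

lemma IsSpannedFrom.empty : G.IsSpannedFrom C ∅ :=
  .inl rfl

lemma IsSpannedFrom.singleton {v : V} (hv : v ∈ C) : G.IsSpannedFrom C {v} :=
  .inr ⟨v, hv, v, hv, .nil, .nil, by simp⟩

lemma IsSpannedFrom.union (hC : G.IsClique C) {X Y : Set V} (hX : G.IsSpannedFrom C X)
    (hY : G.IsSpannedFrom C Y) (hXY : Disjoint X Y) : G.IsSpannedFrom C (X ∪ Y) := by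
  obtain rfl | ⟨a, ha, b, hb, p, hp, hpX⟩ := hX
  · simpa using hY
  obtain rfl | ⟨c, hc, d, hd, q, hq, hqY⟩ := hY
  · rw [Set.union_empty]
    exact .inr ⟨a, ha, b, hb, p, hp, hpX⟩
  rw [Set.disjoint_left] at hXY
  have hbc : G.Adj b c := hC hb hc fun h ↦
    hXY ((hpX b).1 p.end_mem_support) (h ▸ (hqY c).1 q.start_mem_support)
  refine .inr ⟨a, ha, d, hd, p.append (.cons hbc q), ?_, fun x ↦ ?_⟩
  · rw [Walk.isPath_def, Walk.support_append, Walk.support_cons, List.tail_cons]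
    exact hp.support_nodup.append hq.support_nodup fun x hx hx' ↦
      hXY ((hpX x).1 hx) ((hqY x).1 hx')
  · simp [Walk.support_append, hpX, hqY]

lemma IsSpannedFrom.biUnion (hC : G.IsClique C) {ι : Type*} (s : Finset ι) {X : ι → Set V}
    (hX : ∀ i ∈ s, G.IsSpannedFrom C (X i)) (hdisj : Pairwise fun i j ↦ Disjoint (X i) (X j)) :
    G.IsSpannedFrom C (⋃ i ∈ s, X i) := by
  classical
  induction s using Finset.induction_on with
  | empty => simpa using IsSpannedFrom.empty
  | insert i s hi ih =>
    rw [Finset.set_biUnion_insert]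
    refine (hX i (s.mem_insert_self i)).union hC
      (ih fun j hj ↦ hX j (Finset.mem_insert_of_mem hj)) ?_
    exact Set.disjoint_iUnion₂_right.2 fun j hj ↦ hdisj fun h ↦ hi (h ▸ hj)

lemma IsSpannedFrom.of_subset [Finite V] (hC : G.IsClique C) {X : Set V} (hX : X ⊆ C) :
    G.IsSpannedFrom C X := by
  have h := IsSpannedFrom.biUnion hC X.toFinite.toFinset (X := fun v ↦ {v})
    (fun v hv ↦ .singleton (hX (by simpa using hv)))
    fun v w hvw ↦ Set.disjoint_singleton.2 hvw
  simpa using h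

lemma IsSpannedFrom.isHamiltonian [Fintype V] [DecidableEq V] (hC : G.IsClique C)
    (h : G.IsSpannedFrom C Set.univ) {s : V} (hs : s ∉ C) : G.IsHamiltonian := by
  obtain h | ⟨u, hu, v, hv, p, hp, hmem⟩ := h
  · exact absurd (Set.mem_univ s) (h ▸ Set.notMem_empty s)
  have hsu : s ≠ u := fun h ↦ hs (h ▸ hu)
  have hsv : s ≠ v := fun h ↦ hs (h ▸ hv)
  have huv : u ≠ v := by
    rintro rfl
    have hnil := Walk.nil_iff_support_eq.1 (Walk.isPath_iff_nil.1 hp)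
    simpa [hnil, hsu] using hmem s
  have hpH : p.IsHamiltonian := hp.isHamiltonian_of_mem fun x ↦ (hmem x).2 trivial
  have hcard : 2 < Fintype.card V := Fintype.two_lt_card_iff.2 ⟨s, u, v, hsu, hsv, huv⟩
  refine fun _ ↦ ⟨v, .cons (hC hv hu huv.symm) p,
    Walk.isHamiltonianCycle_iff_isCycle_and_length_eq.2 ⟨?_, ?_⟩⟩
  · rw [Walk.isCycle_iff_isPath_tail_and_le_length]
    exact ⟨by simpa using hp, by rw [Walk.length_cons, hpH.length_eq]; omega⟩
  · rw [Walk.length_cons, hpH.length_eq]; omega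

end SimpleGraph

/-- If the vertex set of a simple graph `G` is partitioned into a nonempty set `S` and a
set `C'` inducing a clique, and there is a path cover of `S` in `G` (a collection of
pairwise vertex-disjoint simple paths covering every vertex of `S`) whose paths all have
both endpoints in `C'`, then `G` is Hamiltonian. -/
theorem ham_of_pathCover_clique_endpoints {V : Type*} [Fintype V] [DecidableEq V]
    (G : SimpleGraph V) (S C' : Set V)
    (hS : S.Nonempty)
    (hunion : S ∪ C' = Set.univ) (hdisj : Disjoint S C')
    (hclique : G.IsClique C')
    (hcover : ∃ (m : ℕ) (P : Fin m → Σ u : V, Σ v : V, G.Walk u v),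
      (∀ i, (P i).2.2.IsPath) ∧
      (∀ i j, i ≠ j → ∀ x, x ∈ (P i).2.2.support → x ∉ (P j).2.2.support) ∧
      (∀ x ∈ S, ∃ i, x ∈ (P i).2.2.support) ∧
      (∀ i, (P i).1 ∈ C' ∧ (P i).2.1 ∈ C')) :
    G.IsHamiltonian := by
  obtain ⟨m, P, hpath, hPdisj, hPcover, hends⟩ := hcover
  obtain ⟨s, hs⟩ := hS
  set X : Set V := ⋃ i ∈ Finset.univ, {x | x ∈ (P i).2.2.support} with hX
  have hXspan : G.IsSpannedFrom C' X := .biUnion hclique _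
    (fun i _ ↦ .inr ⟨_, (hends i).1, _, (hends i).2, _, hpath i, fun _ ↦ Iff.rfl⟩)
    fun i j hij ↦ Set.disjoint_left.2 (hPdisj i j hij)
  have hSX : S ⊆ X := fun x hx ↦ by simpa [hX] using hPcover x hx
  have hcompl : Xᶜ ⊆ C' := fun x hx ↦
    ((Set.ext_iff.1 hunion x).2 trivial).resolve_left fun h ↦ hx (hSX h)
  have huniv := hXspan.union hclique (.of_subset hclique hcompl) disjoint_compl_right
  rw [Set.union_compl_self] at huniv
  exact huniv.isHamiltonian hclique (Set.disjoint_left.1 hdisj hs)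
end

section
/- Let G be a simple graph, let S ⊆ V(G) be nonempty, and suppose C := V(G) ∖ S induces a clique in G. Let H be the bipartite simple graph with parts C and S' := S × {1, 2}, in which c ∈ C is adjacent to (v, i) ∈ S' if and only if cv is an edge of G. Let M be a maximum matching of H, let C* ⊆ C be the set of vertices of C saturated by M, and let C' be any set with C* ⊆ C' ⊆ C. If G is Hamiltonian, then the induced subgraph G[C' ∪ S] is Hamiltonian. -/
/-- The auxiliary bipartite graph with parts `C := Sᶜ` and `S' := S × {1,2}`, in which
`c ∈ C` is adjacent to `(v, i) ∈ S'` if and only if `cv` is an edge of `G`. -/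
def bipartiteAux {V : Type*} [Fintype V] [DecidableEq V]
    (G : SimpleGraph V) (S : Finset V) :
    SimpleGraph ((↑(Sᶜ) : Set V) ⊕ ((↑S : Set V) × Fin 2)) :=
  SimpleGraph.fromRel fun a b =>
    match a, b with
    | Sum.inl c, Sum.inr vi => G.Adj c.1 vi.1.1
    | _, _ => False

/-- Hall's condition for one side of a minimum vertex cover of a bipartite relation. -/
theorem exists_injective_of_minimal_cover {α β : Type*} [Fintype β] [DecidableEq α]
    [DecidableEq β] (r : α → β → Prop) (A : Finset α) (B : Finset β)
    (hcover : ∀ a b, r a b → a ∈ A ∨ b ∈ B)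
    (hmin : ∀ (A' : Finset α) (B' : Finset β), (∀ a b, r a b → a ∈ A' ∨ b ∈ B') →
      A.card + B.card ≤ A'.card + B'.card) :
    ∃ f : A → β, Function.Injective f ∧ ∀ a : A, r a (f a) ∧ f a ∉ B := by
  classical
  have hall := (Finset.all_card_le_biUnion_card_iff_exists_injective
    (fun a : A => Finset.univ.filter fun b => r a b ∧ b ∉ B)).1 ?_
  · obtain ⟨f, hf, h⟩ := hall
    exact ⟨f, hf, fun a => by simpa using h a⟩
  · intro s
    set N := s.biUnion (fun a : A => Finset.univ.filter fun b => r a b ∧ b ∉ B) with hN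
    have hsA : s.map (Function.Embedding.subtype _) ⊆ A := by
      intro x hx
      obtain ⟨y, -, rfl⟩ := Finset.mem_map.1 hx
      exact y.2
    have key := hmin (A \ s.map (Function.Embedding.subtype _)) (B ∪ N) ?_
    · have h₁ := Finset.card_sdiff_add_card_eq_card hsA
      have h₂ := Finset.card_union_le B N
      rw [Finset.card_map] at h₁
      omega
    · intro a b hab
      by_cases hb : b ∈ B
      · exact .inr (Finset.mem_union_left _ hb)
      have ha : a ∈ A := (hcover a b hab).resolve_right hb
      by_cases has : (⟨a, ha⟩ : A) ∈ s
      · refine .inr (Finset.mem_union_right _ ?_)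
        rw [hN, Finset.mem_biUnion]
        exact ⟨_, has, by simp [hab, hb]⟩
      · refine .inl (Finset.mem_sdiff.2 ⟨ha, fun h => has ?_⟩)
        obtain ⟨y, hy, rfl⟩ := Finset.mem_map.1 h
        exact hy

/-- **Kőnig's theorem**: a minimum vertex cover of a finite bipartite relation, with matchings
of both of its sides into the complement of the cover. -/
theorem exists_cover_and_matchings {α β : Type*} [Fintype α] [Fintype β] [DecidableEq α]
    [DecidableEq β] (r : α → β → Prop) :
    ∃ (A : Finset α) (B : Finset β), (∀ a b, r a b → a ∈ A ∨ b ∈ B) ∧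
      (∃ f : A → β, Function.Injective f ∧ ∀ a : A, r a (f a) ∧ f a ∉ B) ∧
      ∃ g : B → α, Function.Injective g ∧ ∀ b : B, r (g b) b ∧ g b ∉ A := by
  classical
  obtain ⟨⟨A, B⟩, hAB, hmin⟩ := Finset.exists_min_image
    (Finset.univ.filter fun P : Finset α × Finset β => ∀ a b, r a b → a ∈ P.1 ∨ b ∈ P.2)
    (fun P => P.1.card + P.2.card) ⟨(Finset.univ, Finset.univ), by simp⟩
  simp only [Finset.mem_filter, Finset.mem_univ, true_and, Prod.forall] at hAB hmin
  refine ⟨A, B, hAB, exists_injective_of_minimal_cover r A B hAB hmin,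
    exists_injective_of_minimal_cover (fun b a => r a b) B A (fun b a h => (hAB a b h).symm) ?_⟩
  intro B' A' h
  have := hmin A' B' fun a b hab => (h b a hab).symm
  omega

/-- For a maximum matching `M` of a finite bipartite relation there is a vertex cover that avoids
the unsaturated vertices on the left and whose right vertices are all matched by `M` to left
vertices outside the cover. -/
theorem exists_cover_of_maximum_matching {α β : Type*} [Fintype α] [Fintype β] [DecidableEq α]
    [DecidableEq β] (r : α → β → Prop) (M : Set (Sym2 (α ⊕ β)))
    (hM : ∀ e ∈ M, ∃ a b, r a b ∧ e = s(Sum.inl a, Sum.inr b))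
    (hmatch : M.Pairwise fun e f => ∀ v, v ∈ e → v ∉ f)
    (hmax : ∀ M' : Set (Sym2 (α ⊕ β)), (∀ e ∈ M', ∃ a b, r a b ∧ e = s(Sum.inl a, Sum.inr b)) →
      (M'.Pairwise fun e f => ∀ v, v ∈ e → v ∉ f) → M'.ncard ≤ M.ncard) :
    ∃ (A : Finset α) (B : Finset β), (∀ a b, r a b → a ∈ A ∨ b ∈ B) ∧
      (∀ a ∈ A, ∃ e ∈ M, Sum.inl a ∈ e) ∧
      ∀ b ∈ B, ∃ a, a ∉ A ∧ s(Sum.inl a, Sum.inr b) ∈ M := by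
  classical
  obtain ⟨A, B, hcover, ⟨f, hf, hfr⟩, g, hg, hgr⟩ := exists_cover_and_matchings r
  refine ⟨A, B, hcover, ?_⟩
  let φ : A ⊕ B → Sym2 (α ⊕ β) :=
    Sum.elim (fun a => s(Sum.inl a.1, Sum.inr (f a))) (fun b => s(Sum.inl (g b), Sum.inr b.1))
  have hφ : ∀ x y v, v ∈ φ x → v ∈ φ y → x = y := by
    rintro (x | x) (y | y) (v | v) hx hy <;> simp [φ] at hx hy
    · exact congrArg _ (Subtype.ext (hx.symm.trans hy))
    · exact congrArg _ (hf (hx.symm.trans hy))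
    · exact absurd (hx ▸ x.2) (hy ▸ (hgr y).2)
    · exact absurd (hy ▸ y.2) (hx ▸ (hfr x).2)
    · exact absurd (hy ▸ y.2) (hx ▸ (hgr x).2)
    · exact absurd (hx ▸ x.2) (hy ▸ (hfr y).2)
    · exact congrArg _ (hg (hx.symm.trans hy))
    · exact congrArg _ (Subtype.ext (hx.symm.trans hy))
  have hφinj : Function.Injective φ := by
    intro x y hxy
    obtain ⟨v, hv⟩ : ∃ v, v ∈ φ x := ⟨_, Sym2.out_fst_mem _⟩
    exact hφ x y v hv (hxy ▸ hv)
  have hle : Nat.card (A ⊕ B) ≤ Nat.card M := by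
    have := hmax (Set.range φ) ?_ ?_
    · rwa [← Nat.card_coe_set_eq, ← Nat.card_coe_set_eq,
        ← Nat.card_congr (Equiv.ofInjective φ hφinj)] at this
    · rintro _ ⟨x | x, rfl⟩
      · exact ⟨_, _, (hfr x).1, rfl⟩
      · exact ⟨_, _, (hgr x).1, rfl⟩
    · rintro _ ⟨x, rfl⟩ _ ⟨y, rfl⟩ hxy v hx hy
      exact hxy (congrArg φ (hφ x y v hx hy))
  let ι : A ⊕ B → α ⊕ β := Sum.map Subtype.val Subtype.val
  have hι : Function.Injective ι := Subtype.val_injective.sumMap Subtype.val_injective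
  have hk : ∀ e : M, ∃ x : A ⊕ B, ι x ∈ e.1 := by
    rintro ⟨e, he⟩
    obtain ⟨a, b, hab, rfl⟩ := hM e he
    rcases hcover a b hab with h | h
    · exact ⟨Sum.inl ⟨a, h⟩, by simp [ι]⟩
    · exact ⟨Sum.inr ⟨b, h⟩, by simp [ι]⟩
  choose k hk using hk
  have hdisj : ∀ (e f : M) v, v ∈ e.1 → v ∈ f.1 → e = f := by
    intro e f v he hf
    by_contra hne
    exact hmatch e.2 f.2 (fun h => hne (Subtype.ext h)) v he hf
  have hkinj : Function.Injective k := fun e f hef => hdisj e f _ (hk e) (hef ▸ hk f)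
  have hkbij : Function.Bijective k :=
    (Nat.bijective_iff_injective_and_card k).2
      ⟨hkinj, (Nat.card_le_card_of_injective k hkinj).antisymm hle⟩
  have huniq : ∀ (e : M) x, ι x ∈ e.1 → k e = x := by
    intro e x hx
    obtain ⟨e', rfl⟩ := hkbij.2 x
    rw [hdisj e e' _ hx (hk e')]
  constructor
  · intro a ha
    obtain ⟨e, he⟩ := hkbij.2 (Sum.inl ⟨a, ha⟩)
    refine ⟨e.1, e.2, ?_⟩
    simpa [he, ι] using hk e
  · intro b hb
    obtain ⟨e, he⟩ := hkbij.2 (Sum.inr ⟨b, hb⟩)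
    have hbe : Sum.inr b ∈ e.1 := by simpa [he, ι] using hk e
    obtain ⟨a, b', hab, hab'⟩ := hM e.1 e.2
    have hbb : b = b' := by simpa [hab'] using hbe
    subst hbb
    refine ⟨a, fun ha => ?_, hab' ▸ e.2⟩
    have := huniq e (Sum.inl ⟨a, ha⟩) (by simp [ι, hab'])
    rw [he] at this
    cases this

/-- The crown structure provided by a maximum matching of `bipartiteAux G S`: a set `K` of
vertices outside `S` containing all those outside `C'`, and a set `T ⊆ S` of all neighbours of `K`
in `S`, such that each vertex of `T` has two private neighbours in both `K` and `C'`, given by `p` and `q`. -/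
theorem exists_double_crown {V : Type*} [Fintype V] [DecidableEq V]
    (G : SimpleGraph V) (S : Finset V)
    (M : Set (Sym2 ((↑(Sᶜ) : Set V) ⊕ ((↑S : Set V) × Fin 2))))
    (hME : M ⊆ (bipartiteAux G S).edgeSet)
    (hmatch : M.Pairwise fun e f => ∀ v, v ∈ e → v ∉ f)
    (hmax : ∀ M' : Set (Sym2 ((↑(Sᶜ) : Set V) ⊕ ((↑S : Set V) × Fin 2))),
      M' ⊆ (bipartiteAux G S).edgeSet →
      (M'.Pairwise fun e f => ∀ v, v ∈ e → v ∉ f) → M'.ncard ≤ M.ncard)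
    (C' : Finset V)
    (hCstar : ∀ c : V, ∀ hc : c ∈ Sᶜ,
      (∃ e ∈ M, Sum.inl (⟨c, hc⟩ : (↑(Sᶜ) : Set V)) ∈ e) → c ∈ C') :
    ∃ (K T : Finset V) (p q : V → V), K ⊆ Sᶜ ∧ T ⊆ S ∧ (∀ c ∈ Sᶜ, c ∉ C' → c ∈ K) ∧
      (∀ c ∈ K, ∀ v ∈ S, G.Adj c v → v ∈ T) ∧
      (∀ v ∈ T, p v ∈ K ∧ p v ∈ C' ∧ G.Adj (p v) v) ∧
      (∀ v ∈ T, q v ∈ K ∧ q v ∈ C' ∧ G.Adj (q v) v) ∧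
      (∀ u ∈ T, ∀ v ∈ T, p u = p v → u = v) ∧ (∀ u ∈ T, ∀ v ∈ T, q u = q v → u = v) ∧
      ∀ u ∈ T, ∀ v ∈ T, p u ≠ q v := by
  classical
  have hedge : ∀ e, e ∈ (bipartiteAux G S).edgeSet ↔
      ∃ (a : (↑(Sᶜ) : Set V)) (b : (↑S : Set V) × Fin 2), G.Adj a.1 b.1.1 ∧
        e = s(Sum.inl a, Sum.inr b) := by
    intro e
    induction e with | h x y
    constructor
    · intro h
      simp only [SimpleGraph.mem_edgeSet, bipartiteAux, SimpleGraph.fromRel_adj] at h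
      obtain ⟨-, h⟩ := h
      rcases x with x | x <;> rcases y with y | y <;> simp only [or_false, false_or] at h
      · exact ⟨x, y, h, rfl⟩
      · exact ⟨y, x, h, Sym2.eq_swap⟩
    · rintro ⟨a, b, hab, he⟩
      rw [he, SimpleGraph.mem_edgeSet, bipartiteAux, SimpleGraph.fromRel_adj]
      exact ⟨Sum.inl_ne_inr, .inl hab⟩
  obtain ⟨A, B, hcover, hA, hB⟩ := exists_cover_of_maximum_matching
    (fun (a : (↑(Sᶜ) : Set V)) (b : (↑S : Set V) × Fin 2) => G.Adj a.1 b.1.1) M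
    (fun e he => (hedge e).1 (hME he)) hmatch
    (fun M' h => hmax M' fun e he => (hedge e).2 (h e he))
  rcases isEmpty_or_nonempty (↑(Sᶜ) : Set V) with hempty | hnonempty
  · exact ⟨∅, ∅, id, id, by simp, by simp, fun c hc => (hempty.false ⟨c, hc⟩).elim, by simp⟩
  choose! m hm using hB
  have hmC : ∀ b, (m b).1 ∈ Sᶜ := fun b => (m b).2
  have hmadj : ∀ b ∈ B, G.Adj (m b).1 b.1.1 := by
    intro b hb
    obtain ⟨a, b', h, h'⟩ := (hedge _).1 (hME (hm b hb).2)
    obtain ⟨h₁, h₂⟩ : m b = a ∧ b = b' := by simpa using h'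
    rw [h₁, h₂]
    exact h
  have hminj : ∀ b ∈ B, ∀ b' ∈ B, (m b).1 = (m b').1 → b = b' := by
    intro b hb b' hb' h
    by_contra hne
    have h := Subtype.ext h
    refine hmatch (hm b hb).2 (hm b' hb').2 (fun he => hne ?_) (Sum.inl (m b)) (by simp) (by simp [h])
    simpa [h] using he
  let K : Finset V := Finset.univ.filter fun c => ∃ h : c ∈ (↑(Sᶜ) : Set V), ⟨c, h⟩ ∉ A
  let T : Finset V := Finset.univ.filter fun v => ∃ h : v ∈ (↑S : Set V), ∀ i, (⟨v, h⟩, i) ∈ B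
  let n : Fin 2 → V → V := fun i v => if h : v ∈ (↑S : Set V) then (m (⟨v, h⟩, i)).1 else v
  have hT : ∀ v ∈ T, ∃ h : v ∈ (↑S : Set V), ∀ i, (⟨v, h⟩, i) ∈ B ∧ n i v = (m (⟨v, h⟩, i)).1 := by
    intro v hv
    obtain ⟨h, h'⟩ := (Finset.mem_filter.1 hv).2
    exact ⟨h, fun i => ⟨h' i, dif_pos h⟩⟩
  have hn : ∀ i, ∀ v ∈ T, n i v ∈ K ∧ n i v ∈ C' ∧ G.Adj (n i v) v := by
    intro i v hv
    obtain ⟨h, h'⟩ := hT v hv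
    rw [(h' i).2]
    refine ⟨?_, ?_, hmadj _ (h' i).1⟩
    · exact Finset.mem_filter.2 ⟨Finset.mem_univ _, (m _).2, (hm _ (h' i).1).1⟩
    · exact hCstar _ (hmC _) ⟨_, (hm _ (h' i).1).2, by simp⟩
  have hninj : ∀ i j, ∀ u ∈ T, ∀ v ∈ T, n i u = n j v → u = v ∧ i = j := by
    intro i j u hu v hv huv
    obtain ⟨h₁, h₁'⟩ := hT u hu
    obtain ⟨h₂, h₂'⟩ := hT v hv
    rw [(h₁' i).2, (h₂' j).2] at huv
    simpa using hminj _ (h₁' i).1 _ (h₂' j).1 huv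
  refine ⟨K, T, n 0, n 1, ?_, ?_, ?_, ?_, hn 0, hn 1, fun u hu v hv h => (hninj _ _ u hu v hv h).1,
    fun u hu v hv h => (hninj _ _ u hu v hv h).1, fun u hu v hv h => ?_⟩
  · intro c hc
    obtain ⟨h, -⟩ := (Finset.mem_filter.1 hc).2
    exact h
  · intro v hv
    obtain ⟨h, -⟩ := (Finset.mem_filter.1 hv).2
    exact h
  · intro c hc hcC
    refine Finset.mem_filter.2 ⟨Finset.mem_univ _, hc, fun h => hcC (hCstar c hc (hA _ h))⟩
  · intro c hc v hv hcv
    obtain ⟨h, h'⟩ := (Finset.mem_filter.1 hc).2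
    exact Finset.mem_filter.2 ⟨Finset.mem_univ _, hv, fun i =>
      (hcover ⟨c, h⟩ (⟨v, hv⟩, i) hcv).resolve_left h'⟩
  · exact absurd (hninj _ _ u hu v hv h).2 (by decide)

/-- Reroute a list of vertices: drop the vertices of `K`, and at each passage between `v ∈ T` and
`C` insert `p v` (when entering `v`) or `q v` (when leaving `v`). The first argument is the vertex
preceding the list. -/
def reroute {V : Type*} [DecidableEq V] (C K T : Finset V) (p q : V → V) : V → List V → List V
  | _, [] => []
  | a, b :: l =>
    (if a ∈ T ∧ b ∈ C then [q a] else []) ++ (if a ∈ C ∧ b ∈ T then [p b] else []) ++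
      (if b ∈ K then [] else [b]) ++ reroute C K T p q b l

theorem mem_of_mem_reroute {V : Type*} [DecidableEq V] {C K T : Finset V} {p q : V → V} {y : V} :
    ∀ {a : V} {l : List V}, y ∈ reroute C K T p q a l →
      (y ∈ l ∧ y ∉ K) ∨ (∃ v ∈ l, v ∈ T ∧ y = p v) ∨ ∃ v ∈ a :: l, v ∈ T ∧ y = q v
  | a, [], h => by simp [reroute] at h
  | a, b :: l, h => by
    have ih := mem_of_mem_reroute (C := C) (K := K) (T := T) (p := p) (q := q) (y := y)
      (a := b) (l := l)
    simp only [reroute, List.mem_append] at h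
    grind

theorem mem_reroute {V : Type*} [DecidableEq V] {C K T : Finset V} {p q : V → V} {y : V}
    (hy : y ∉ K) : ∀ {a : V} {l : List V}, y ∈ l → y ∈ reroute C K T p q a l
  | a, b :: l, h => by
    have ih := mem_reroute (C := C) (K := K) (T := T) (p := p) (q := q) hy (a := b) (l := l)
    simp only [reroute, List.mem_append]
    grind

theorem nodup_reroute {V : Type*} [DecidableEq V] {C K T : Finset V} {p q : V → V}
    (hCT : Disjoint C T) (hp : ∀ v ∈ T, p v ∈ K) (hq : ∀ v ∈ T, q v ∈ K)
    (hpp : ∀ u ∈ T, ∀ v ∈ T, p u = p v → u = v) (hqq : ∀ u ∈ T, ∀ v ∈ T, q u = q v → u = v)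
    (hpq : ∀ u ∈ T, ∀ v ∈ T, p u ≠ q v) :
    ∀ {a : V} {l : List V}, l.Nodup → (a ∈ T → a ∉ l) → (reroute C K T p q a l).Nodup
  | a, [], _, _ => by simp [reroute]
  | a, b :: l, hl, ha => by
    have hbl : b ∉ l := (List.nodup_cons.1 hl).1
    have ih := nodup_reroute hCT hp hq hpp hqq hpq (a := b) (List.nodup_cons.1 hl).2 fun _ => hbl
    have hmem : ∀ y, y ∈ reroute C K T p q b l → _ := fun y => mem_of_mem_reroute
    have hd := Finset.disjoint_left.1 hCT
    simp only [reroute]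
    by_cases h₁ : a ∈ T ∧ b ∈ C
    · have h₂ : ¬ (a ∈ C ∧ b ∈ T) := fun h => hd h.1 h₁.1
      by_cases h₃ : b ∈ K <;> simp only [h₁, h₂, h₃, if_true, if_false, and_self,
        List.nil_append, List.append_nil, List.cons_append, List.nodup_cons] <;> grind
    · by_cases h₂ : a ∈ C ∧ b ∈ T <;> by_cases h₃ : b ∈ K <;>
        simp only [h₁, h₂, h₃, if_true, if_false, and_self, List.nil_append, List.append_nil,
          List.cons_append, List.nodup_cons] <;> grind

theorem isChain_reroute {V : Type*} [DecidableEq V] {G : SimpleGraph V} {C K T : Finset V}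
    {p q : V → V} {R : V → V → Prop} {rest : List V}
    (hCT : Disjoint C T) (hKC : K ⊆ C)
    (hKT : ∀ c ∈ K, ∀ v, G.Adj c v → v ∈ C ∨ v ∈ T)
    (hp : ∀ v ∈ T, p v ∈ C ∧ R (p v) v) (hq : ∀ v ∈ T, q v ∈ C ∧ R v (q v))
    (hRC : ∀ u ∈ C, ∀ v ∈ C, R u v) (hRG : ∀ u v, u ∉ K → v ∉ K → G.Adj u v → R u v)
    (hrest : ∀ v ∈ rest, v ∈ C) :
    ∀ {a : V} {l : List V} {x : V}, (a :: l).IsChain G.Adj →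
      (a :: l).getLast (List.cons_ne_nil a l) ∈ C → (a ∉ K → x = a) → (a ∈ C → x ∈ C) →
      (x :: (reroute C K T p q a l ++ rest)).IsChain R
  | a, [], x, _, hlast, _, hx => by
    have hxC : x ∈ C := hx (by simpa using hlast)
    have : ∀ v ∈ x :: rest, v ∈ C := by simpa [hxC] using hrest
    simp only [reroute, List.nil_append]
    exact (List.pairwise_iff_forall_sublist.2 fun {u v} h =>
      hRC u (this u (h.subset (by simp))) v (this v (h.subset (by simp)))).isChain
  | a, b :: l, x, hch, hlast, hxa, hxC => by
    have hab : G.Adj a b := (List.isChain_cons_cons.1 hch).1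
    have ih := fun y => isChain_reroute hCT hKC hKT hp hq hRC hRG hrest (a := b) (l := l) (x := y)
      (List.isChain_cons_cons.1 hch).2 (by simpa using hlast)
    have hd := Finset.disjoint_left.1 hCT
    have hab' := hab.symm
    simp only [reroute]
    have hKC' : ∀ v, v ∈ K → v ∈ C := fun v => @hKC v
    have ha := hKT a
    have hb := hKT b
    have hR := hRG a b
    clear hch hlast hrest hRG hKT hKC hCT
    generalize reroute C K T p q b l = m at ih ⊢
    by_cases h₁ : a ∈ T ∧ b ∈ C
    · have h₂ : ¬ (a ∈ C ∧ b ∈ T) := fun h => hd h.1 h₁.1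
      by_cases h₃ : b ∈ K <;> simp only [h₁, h₂, h₃, if_true, if_false, and_self,
        List.nil_append, List.append_nil, List.cons_append, List.isChain_cons_cons] <;> grind
    · by_cases h₂ : a ∈ C ∧ b ∈ T
      · by_cases h₃ : b ∈ K <;> simp only [h₁, h₂, h₃, if_true, if_false, and_self,
          List.nil_append, List.append_nil, List.cons_append, List.isChain_cons_cons] <;> grind
      · have hx : b ∉ K → R x b := by
          intro hbK
          by_cases haK : a ∈ K
          · rcases ha haK b hab with h | h
            · exact hRC x (hxC (hKC' a haK)) b h
            · exact absurd ⟨hKC' a haK, h⟩ h₂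
          · rw [hxa haK]
            exact hR haK hbK hab
        have hxb : b ∈ K → x ∈ C := by
          intro hbK
          rcases hb hbK a hab' with h | h
          · exact hxC h
          · exact absurd ⟨h, hKC' b hbK⟩ h₁
        by_cases h₃ : b ∈ K
        · simpa [h₁, h₂, h₃] using ih x (absurd h₃) fun _ => hxb h₃
        · simpa [h₁, h₂, h₃] using ⟨hx h₃, ih b (fun _ => rfl) id⟩

theorem SimpleGraph.isHamiltonian_of_list {V : Type*} [Fintype V] [DecidableEq V]
    {G : SimpleGraph V} {l : List V} (hnd : l.Nodup) (hmem : ∀ v, v ∈ l) (hl : 3 ≤ l.length)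
    (hch : l.IsChain G.Adj) (hne : l ≠ []) (hclose : G.Adj (l.getLast hne) (l.head hne)) :
    G.IsHamiltonian := by
  intro _
  have hpath : (Walk.ofSupport l hne hch).IsPath := .mk' (by simpa using hnd)
  refine ⟨_, .cons hclose (.ofSupport l hne hch), ?_⟩
  rw [Walk.isHamiltonianCycle_iff_isCycle_and_length_eq]
  constructor
  · refine (Walk.cons_isCycle_iff _ _).2 ⟨hpath, fun h => ?_⟩
    rw [Sym2.eq_swap] at h
    have := hpath.length_eq_one_of_mem_edges h
    rw [Walk.length_ofSupport] at this
    omega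
  · have huniv : l.toFinset = Finset.univ := Finset.eq_univ_of_forall (by simpa using hmem)
    rw [Walk.length_cons, Walk.length_ofSupport, ← Finset.card_univ, ← huniv,
      List.toFinset_card_of_nodup hnd]
    omega

theorem SimpleGraph.induce_isHamiltonian_of_list {V : Type*} [Fintype V] [DecidableEq V]
    {G : SimpleGraph V} {T : Finset V} {l : List V} (hnd : l.Nodup) (hmem : ∀ v, v ∈ l ↔ v ∈ T)
    (hl : 3 ≤ l.length) (hch : l.IsChain G.Adj) (hne : l ≠ [])
    (hclose : G.Adj (l.getLast hne) (l.head hne)) :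
    (G.induce (↑T : Set V)).IsHamiltonian := by
  lift l to List (↑T : Set V) using fun v hv => (hmem v).1 hv
  rw [List.getLast_map, List.head_map] at hclose
  refine isHamiltonian_of_list (l := l) hnd.of_map (fun v => ?_) (by simpa using hl)
    ((List.isChain_map Subtype.val).1 hch) (fun h => hne (by simp [h])) hclose
  have := (hmem v).2 v.2
  simpa using this

/-- Let `S` be a nonempty vertex set of `G` whose complement `C := Sᶜ` induces a clique,
let `M` be a maximum matching of the auxiliary bipartite graph with parts `C` and
`S × {1,2}`, let `C*` be the set of vertices of `C` saturated by `M`, and let `C'` be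
any set with `C* ⊆ C' ⊆ C`. If `G` is Hamiltonian, then `G[C' ∪ S]` is Hamiltonian. -/
theorem induce_ham_of_ham {V : Type*} [Fintype V] [DecidableEq V]
    (G : SimpleGraph V) (S : Finset V) (hS : S.Nonempty)
    (hclique : G.IsClique (↑(Sᶜ) : Set V))
    (M : Set (Sym2 ((↑(Sᶜ) : Set V) ⊕ ((↑S : Set V) × Fin 2))))
    (hME : M ⊆ (bipartiteAux G S).edgeSet)
    (hmatch : M.Pairwise fun e f => ∀ v, v ∈ e → v ∉ f)
    (hmax : ∀ M' : Set (Sym2 ((↑(Sᶜ) : Set V) ⊕ ((↑S : Set V) × Fin 2))),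
      M' ⊆ (bipartiteAux G S).edgeSet →
      (M'.Pairwise fun e f => ∀ v, v ∈ e → v ∉ f) → M'.ncard ≤ M.ncard)
    (C' : Finset V) (hC'sub : C' ⊆ Sᶜ)
    (hCstar : ∀ c : V, ∀ hc : c ∈ Sᶜ,
      (∃ e ∈ M, Sum.inl (⟨c, hc⟩ : (↑(Sᶜ) : Set V)) ∈ e) → c ∈ C')
    (hham : G.IsHamiltonian) :
    (G.induce (↑(C' ∪ S) : Set V)).IsHamiltonian := by
  by_cases hall : ∀ v, v ∈ C' ∪ S
  · let φ : G →g G.induce (↑(C' ∪ S) : Set V) := ⟨fun v => ⟨v, hall v⟩, fun h => h⟩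
    have hφ : Function.Bijective φ :=
      ⟨fun u v h => congrArg Subtype.val h, fun v => ⟨v.1, rfl⟩⟩
    intro hcard
    obtain ⟨a, p, hp⟩ := hham (Fintype.card_of_bijective hφ ▸ hcard)
    exact ⟨_, p.map φ, hp.map hφ⟩
  push Not at hall
  obtain ⟨c₀, hc₀⟩ := hall
  obtain ⟨hc₀C', hc₀S⟩ : c₀ ∉ C' ∧ c₀ ∉ S := by simpa using hc₀
  obtain ⟨s₀, hs₀⟩ := hS
  have : Nontrivial V := ⟨c₀, s₀, fun h => hc₀S (h ▸ hs₀)⟩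
  obtain ⟨w, hw⟩ := hham.exists_isHamiltonianCycle c₀
  obtain ⟨K, T, p, q, hKC, hTS, hK, hKT, hp, hq, hpp, hqq, hpq⟩ :=
    exists_double_crown G S M hME hmatch hmax C' hCstar
  have hCT : Disjoint Sᶜ T := disjoint_compl_left.mono_right hTS
  have hc₀C : c₀ ∈ Sᶜ := Finset.mem_compl.2 hc₀S
  have hc₀K : c₀ ∈ K := hK c₀ hc₀C hc₀C'
  set t := w.support.tail with ht
  have hwt : w.support = c₀ :: t := by rw [ht, SimpleGraph.Walk.cons_tail_support]
  have htnd : t.Nodup := hw.isCycle.support_nodup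
  have htmem : ∀ v, v ∈ t := by
    intro v
    have := hw.isHamiltonian_tail.mem_support v
    rwa [SimpleGraph.Walk.support_tail_of_not_nil _ hw.isCycle.not_nil] at this
  have hch : (c₀ :: t).IsChain G.Adj := hwt ▸ w.isChain_adj_support
  have hlast : (c₀ :: t).getLast (List.cons_ne_nil _ _) = c₀ := by
    have := w.getLast_support
    simpa only [hwt] using this
  -- `c₀` is used as a sentinel: the only related pairs involving it lie inside the clique
  let R : V → V → Prop := fun u v => (G.Adj u v ∧ u ≠ c₀ ∧ v ≠ c₀) ∨ (u ∈ Sᶜ ∧ v ∈ Sᶜ)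
  set F := reroute Sᶜ K T p q c₀ t with hF
  set D := (C'.filter (· ∉ F)).toList with hD
  have hpc : ∀ v ∈ T, p v ≠ c₀ := fun v hv h => hc₀C' (h ▸ (hp v hv).2.1)
  have hqc : ∀ v ∈ T, q v ≠ c₀ := fun v hv h => hc₀C' (h ▸ (hq v hv).2.1)
  have hTc : ∀ v ∈ T, v ≠ c₀ := fun v hv h => hc₀S (h ▸ hTS hv)
  have hchain : (c₀ :: (F ++ (D ++ [c₀]))).IsChain R := by
    refine isChain_reroute (G := G) hCT hKC ?_ ?_ ?_ ?_ ?_ ?_ hch (by rw [hlast]; exact hc₀C)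
      (fun _ => rfl) id
    · intro c hc v hcv
      by_cases hv : v ∈ S
      · exact .inr (hKT c hc v hv hcv)
      · exact .inl (Finset.mem_compl.2 hv)
    · exact fun v hv => ⟨hKC (hp v hv).1, .inl ⟨(hp v hv).2.2, hpc v hv, hTc v hv⟩⟩
    · exact fun v hv => ⟨hKC (hq v hv).1, .inl ⟨(hq v hv).2.2.symm, hTc v hv, hqc v hv⟩⟩
    · exact fun u hu v hv => .inr ⟨hu, hv⟩
    · exact fun u v hu hv h => .inl ⟨h, fun e => hu (e ▸ hc₀K), fun e => hv (e ▸ hc₀K)⟩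
    · intro v hv
      rcases List.mem_append.1 hv with h | h
      · exact hC'sub (Finset.mem_filter.1 (Finset.mem_toList.1 h)).1
      · rwa [List.mem_singleton.1 h]
  have hFmem : ∀ v ∈ F, v ∈ C' ∪ S := by
    intro v hv
    rcases mem_of_mem_reroute hv with ⟨-, h⟩ | ⟨u, -, hu, rfl⟩ | ⟨u, -, hu, rfl⟩
    · by_contra h'
      obtain ⟨h₁, h₂⟩ : v ∉ C' ∧ v ∉ S := by simpa using h'
      exact h (hK v (Finset.mem_compl.2 h₂) h₁)
    · exact Finset.mem_union_left _ (hp u hu).2.1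
    · exact Finset.mem_union_left _ (hq u hu).2.1
  have hmem : ∀ v, v ∈ F ++ D ↔ v ∈ C' ∪ S := by
    intro v
    constructor
    · intro hv
      rcases List.mem_append.1 hv with h | h
      · exact hFmem v h
      · exact Finset.mem_union_left _ (Finset.mem_filter.1 (Finset.mem_toList.1 h)).1
    · intro hv
      by_cases hvF : v ∈ F
      · exact List.mem_append_left _ hvF
      rcases Finset.mem_union.1 hv with h | h
      · exact List.mem_append_right _ (Finset.mem_toList.2 (Finset.mem_filter.2 ⟨h, hvF⟩))
      · exact absurd (mem_reroute (fun hvK => Finset.mem_compl.1 (hKC hvK) h) (htmem v)) hvF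
  have hnd : (F ++ D).Nodup := by
    refine List.nodup_append'.2 ⟨nodup_reroute hCT (fun v hv => (hp v hv).1)
      (fun v hv => (hq v hv).1) hpp hqq hpq htnd (fun h => absurd rfl (hTc c₀ h)),
      Finset.nodup_toList _, ?_⟩
    intro v hvF hvD
    exact (Finset.mem_filter.1 (Finset.mem_toList.1 hvD)).2 hvF
  have hs₀L : s₀ ∈ F ++ D := (hmem s₀).2 (Finset.mem_union_right _ hs₀)
  have hne : F ++ D ≠ [] := List.ne_nil_of_mem hs₀L
  rw [← List.append_assoc] at hchain
  generalize F ++ D = L at *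
  have hsC : s₀ ∉ Sᶜ := by simpa using hs₀
  have hmain : L.IsChain R ∧ L.head hne ∈ Sᶜ ∧ L.getLast hne ∈ Sᶜ := by
    obtain ⟨h₁, h₂, h₃⟩ := List.isChain_append.1 (List.isChain_cons.1 hchain).2
    have h₄ := (List.isChain_cons.1 hchain).1 (L.head hne)
      (by simp [List.head?_append, List.head?_eq_some_head hne])
    have h₅ := h₃ (L.getLast hne) (by simp [List.getLast?_eq_some_getLast hne]) c₀ (by simp)
    refine ⟨h₁, ?_, ?_⟩
    · rcases h₄ with h | h
      · exact absurd rfl h.2.1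
      · exact h.2
    · rcases h₅ with h | h
      · exact absurd rfl h.2.2
      · exact h.1
  obtain ⟨hLR, hhead, hlastC⟩ := hmain
  have hRadj : ∀ u v, R u v → u ≠ v → G.Adj u v := by
    rintro u v (h | ⟨hu, hv⟩) huv
    · exact h.1
    · exact hclique hu hv huv
  have hlen : 3 ≤ L.length := by
    by_contra hlt
    match L, hlt with
    | [], _ => simp at hs₀L
    | [a], _ => grind
    | [a, b], _ => grind
    | _ :: _ :: _ :: _, h => simp at h
  refine SimpleGraph.induce_isHamiltonian_of_list hnd hmem hlen ?_ hne ?_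
  · rw [List.isChain_iff_getElem] at hLR ⊢
    exact fun i hi => hRadj _ _ (hLR i hi) fun h => by
      have := hnd.getElem_inj_iff.1 h
      omega
  · refine hclique hlastC hhead ?_
    rw [List.getLast_eq_getElem, List.head_eq_getElem]
    intro h
    have := hnd.getElem_inj_iff.1 h
    omega
end

section
/- Let G be a simple graph and let H be a Hamiltonian cycle of G, regarded as a connected 2-regular spanning subgraph of G. Let the vertex set of G be partitioned into two nonempty sets S and T. Then the induced subgraphs H[S] and H[T] have the same number of connected components. -/
namespace SimpleGraph

variable {V : Type*} {G : SimpleGraph V}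

open scoped Classical in
theorem IsAcyclic.sum_degree_add_two_mul_card_connectedComponent [Fintype V]
    (hG : G.IsAcyclic) :
    ∑ v, G.degree v + 2 * Nat.card G.ConnectedComponent = 2 * Fintype.card V := by
  have hcomp (c : G.ConnectedComponent) :
      ∑ v : {v // G.connectedComponentMk v = c}, G.degree v + 2 =
        2 * Fintype.card {v // G.connectedComponentMk v = c} := by
    have hsub (v : c.supp) : G.neighborSet v ⊆ c.supp := fun w hw ↦
      (c.mem_supp_congr_adj hw).mp v.2
    have htree : (G.induce c.supp).IsTree := hG.isTree_connectedComponent c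
    have hsum : ∑ v : c.supp, G.degree v + 2 = 2 * Fintype.card c.supp := by
      rw [← htree.card_edgeFinset, mul_add, ← sum_degrees_eq_twice_card_edges]
      simp only [mul_one, add_left_inj]
      exact Finset.sum_congr rfl fun v _ ↦
        (by convert (degree_induce_of_neighborSet_subset (hsub v)).symm)
    convert hsum <;> rfl
  rw [← Fintype.sum_fiberwise G.connectedComponentMk, Nat.card_eq_fintype_card, mul_comm 2,
    ← smul_eq_mul, ← Finset.card_univ, ← Finset.sum_const, ← Finset.sum_add_distrib,
    Finset.sum_congr rfl fun c _ ↦ hcomp c, ← Finset.mul_sum, ← Fintype.card_sigma,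
    Fintype.card_congr (Equiv.sigmaFiberEquiv G.connectedComponentMk)]

theorem Connected.mem_support_of_isCycle_of_isCycles [G.LocallyFinite] (hconn : G.Connected)
    (hcyc : G.IsCycles) {u : V} {p : G.Walk u u} (hp : p.IsCycle) (v : V) : v ∈ p.support := by
  induction (reachable_iff_reflTransGen u v).mp (hconn u v) with
  | refl => exact p.start_mem_support
  | tail _ hadj ih =>
    rw [← p.mem_verts_toSubgraph] at ih ⊢
    exact ((hp.adj_toSubgraph_iff_of_isCycles hcyc ih _).mpr hadj).snd_mem

theorem Connected.isAcyclic_induce_of_isCycles [G.LocallyFinite] (hconn : G.Connected)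
    (hcyc : G.IsCycles) {s : Set V} (hs : sᶜ.Nonempty) : (G.induce s).IsAcyclic := by
  intro v p hp
  obtain ⟨w, hw⟩ := hs
  have hmap := hp.map (f := (Embedding.induce s).toHom) (Embedding.induce (G := G) s).injective
  have hmem := hconn.mem_support_of_isCycle_of_isCycles hcyc hmap w
  rw [Walk.support_map, List.mem_map] at hmem
  obtain ⟨x, -, rfl⟩ := hmem
  exact hw x.2

theorem IsRegularOfDegree.isCycles [G.LocallyFinite] (hG : G.IsRegularOfDegree 2) :
    G.IsCycles := fun v _ ↦ by
  rw [← hG v, ← card_neighborSet_eq_degree, Set.ncard_eq_toFinset_card', Set.toFinset_card]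

theorem degree_eq_degree_induce_add_sum_compl [Fintype V] [DecidableEq V] [DecidableRel G.Adj]
    (s : Finset V) (v : s) [Fintype ((G.induce (s : Set V)).neighborSet v)] :
    G.degree v = (G.induce (s : Set V)).degree v + ∑ w ∈ sᶜ, if G.Adj v w then 1 else 0 := by
  have hG := degree_eq_sum_if_adj (R := ℕ) G v.1
  have hs : (G.induce (s : Set V)).degree v = ∑ w : s, if G.Adj v w then 1 else 0 := by
    convert degree_eq_sum_if_adj (R := ℕ) (G.induce (s : Set V)) v using 1
    · rw [Nat.cast_id]
      congr!
    · rfl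
  rw [Nat.cast_id] at hG
  rw [hG, hs, Finset.sum_coe_sort s fun w ↦ if G.Adj v w then 1 else 0,
    Finset.sum_add_sum_compl]

theorem Connected.card_interedges_compl_of_isRegularOfDegree_two [Fintype V] [DecidableEq V]
    [DecidableRel G.Adj] (hconn : G.Connected) (hreg : G.IsRegularOfDegree 2) {s : Finset V}
    (hs : sᶜ.Nonempty) :
    (G.interedges s sᶜ).card = 2 * Nat.card (G.induce (s : Set V)).ConnectedComponent := by
  classical
  have hforest : ∑ v : (s : Set V), (G.induce (s : Set V)).degree v +
      2 * Nat.card (G.induce (s : Set V)).ConnectedComponent =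
        2 * Fintype.card (s : Set V) := by
    convert (hconn.isAcyclic_induce_of_isCycles hreg.isCycles (s := (s : Set V))
      (by exact_mod_cast hs)).sum_degree_add_two_mul_card_connectedComponent
  have hsum : s.card * 2 = ∑ v : (s : Set V), (G.induce (s : Set V)).degree v +
      (G.interedges s sᶜ).card := by
    rw [interedges_def, Finset.card_filter, Finset.sum_product,
      ← Finset.sum_coe_sort s fun v ↦ ∑ w ∈ sᶜ, if G.Adj v w then 1 else 0,
      ← smul_eq_mul, ← Finset.sum_const, ← Finset.sum_coe_sort s]
    refine Eq.trans ?_ Finset.sum_add_distrib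
    exact Finset.sum_congr rfl fun v _ ↦
      (hreg.degree_eq v.1).symm.trans (degree_eq_degree_induce_add_sum_compl s v)
  have hcard : Fintype.card (s : Set V) = s.card := Fintype.card_coe s
  rw [hcard, mul_comm 2 s.card, hsum] at hforest
  exact (Nat.add_left_cancel hforest).symm

end SimpleGraph

/-- Let `H` be a Hamiltonian cycle of a simple graph `G`, regarded as a connected
2-regular spanning subgraph of `G`, and let the vertex set be partitioned into two
nonempty sets `S` and `T`. Then the induced subgraphs `H[S]` and `H[T]` have the same
number of connected components. -/
theorem ham_cycle_induced_components {V : Type*} [Fintype V] [DecidableEq V]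
    (G H : SimpleGraph V) [DecidableRel H.Adj]
    (hle : H ≤ G) (hconn : H.Connected) (hreg : ∀ v : V, H.degree v = 2)
    (S T : Set V)
    (hunion : S ∪ T = Set.univ) (hdisj : Disjoint S T)
    (hSne : S.Nonempty) (hTne : T.Nonempty) :
    Nat.card (H.induce S).ConnectedComponent =
      Nat.card (H.induce T).ConnectedComponent := by
  obtain rfl : T = Sᶜ := (IsCompl.of_eq hdisj.inter_eq hunion).compl_eq.symm
  lift S to Finset V using S.toFinite
  rw [← Finset.coe_compl] at hTne ⊢
  have hS := hconn.card_interedges_compl_of_isRegularOfDegree_two hreg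
    (Finset.coe_nonempty.mp hTne)
  have hT := hconn.card_interedges_compl_of_isRegularOfDegree_two hreg (s := Sᶜ)
    (by rwa [compl_compl, ← Finset.coe_nonempty])
  have hcomm : (H.interedges S Sᶜ).card = (H.interedges Sᶜ S).card :=
    have := H.symm
    Rel.card_interedges_comm S Sᶜ
  rw [compl_compl, ← hcomm, hS] at hT
  exact Nat.mul_left_cancel two_pos hT
end

section
/- Let G be a simple graph whose vertex set is partitioned into two nonempty sets S and T such that the induced subgraph G[T] has at least |S| connected components. Then no Hamiltonian cycle of G contains an edge with both endpoints in S. -/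
/-- A closed walk that visits both a set and its complement has a dart leaving the set. -/
theorem SimpleGraph.Walk.exists_dart_leaving {V : Type*} [DecidableEq V] {G : SimpleGraph V}
    {v : V} (p : G.Walk v v) (X : Set V) {x y : V} (hx : x ∈ p.support) (hy : y ∈ p.support)
    (hxX : x ∈ X) (hyX : y ∉ X) : ∃ d ∈ p.darts, d.fst ∈ X ∧ d.snd ∉ X := by
  by_cases hv : v ∈ X
  · obtain ⟨d, hd, h⟩ := (p.takeUntil y hy).exists_boundary_dart X hv hyX
    exact ⟨d, p.darts_takeUntil_subset_darts hy hd, h⟩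
  · obtain ⟨d, hd, h⟩ := (p.dropUntil x hx).exists_boundary_dart X hxX hv
    exact ⟨d, p.darts_dropUntil_subset_darts hx hd, h⟩

/-- Distinct darts of a cycle have distinct heads. -/
theorem SimpleGraph.Walk.IsCycle.dart_eq_of_snd_eq {V : Type*} {G : SimpleGraph V} {v : V}
    {p : G.Walk v v} (hp : p.IsCycle) {d e : G.Dart} (hd : d ∈ p.darts) (he : e ∈ p.darts)
    (h : d.snd = e.snd) : d = e := by
  have hnodup : (p.darts.map (·.snd)).Nodup := by
    rw [p.map_snd_darts]
    exact hp.support_nodup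
  exact List.inj_on_of_nodup_map hnodup hd he h

/-- If the vertex set of `G` is partitioned into nonempty sets `S` and `T` such that
`G[T]` has at least `|S|` connected components, then no Hamiltonian cycle of `G`
contains an edge with both endpoints in `S`. -/
theorem no_edge_in_S_of_many_components {V : Type*} [Fintype V] [DecidableEq V]
    (G : SimpleGraph V) (S T : Set V)
    (hunion : S ∪ T = Set.univ) (hdisj : Disjoint S T)
    (hSne : S.Nonempty) (hTne : T.Nonempty)
    (hcomp : S.ncard ≤ Nat.card (G.induce T).ConnectedComponent) :
    ∀ (v : V) (p : G.Walk v v), p.IsHamiltonianCycle →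
      ∀ a b : V, a ∈ S → b ∈ S → s(a, b) ∉ p.edges := by
  intro v p hp a b ha hb hab
  obtain ⟨s, hs⟩ := hSne
  have hleave : ∀ C : (G.induce T).ConnectedComponent, ∃ d ∈ p.darts,
      (∃ h : d.fst ∈ T, (G.induce T).connectedComponentMk ⟨d.fst, h⟩ = C) ∧ d.snd ∈ S := by
    intro C
    obtain ⟨t, rfl⟩ := C.exists_rep
    obtain ⟨d, hd, ⟨hT, hC⟩, hnot⟩ := p.exists_dart_leaving
      {x | ∃ h : x ∈ T, (G.induce T).connectedComponentMk ⟨x, h⟩ =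
        (G.induce T).connectedComponentMk t}
      (hp.mem_support t) (hp.mem_support s) ⟨t.2, rfl⟩
      (fun ⟨h, _⟩ => hdisj.notMem_of_mem_left hs h)
    refine ⟨d, hd, ⟨hT, hC⟩, ?_⟩
    by_contra hS
    have hT' : d.snd ∈ T := (hunion.ge (Set.mem_univ d.snd)).resolve_left hS
    refine hnot ⟨hT', Eq.trans ?_ hC⟩
    have hadj : (G.induce T).Adj ⟨d.snd, hT'⟩ ⟨d.fst, hT⟩ := d.adj.symm
    exact SimpleGraph.ConnectedComponent.sound hadj.reachable
  choose f hf hfC hfS using hleave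
  let g : (G.induce T).ConnectedComponent → S := fun C => ⟨(f C).snd, hfS C⟩
  have hg : Function.Injective g := by
    intro C D h
    have hfe : f C = f D := hp.isCycle.dart_eq_of_snd_eq (hf C) (hf D) (congrArg Subtype.val h)
    obtain ⟨_, hC⟩ := hfC C
    obtain ⟨_, hD⟩ := hfC D
    rw [← hC, ← hD]
    simp only [hfe]
  have hsurj : Function.Surjective g :=
    (hg.bijective_of_nat_card_le (by rwa [Nat.card_coe_set_eq])).surjective
  obtain ⟨e, he, hedge⟩ := List.mem_map.mp hab
  have hends : e.fst ∈ S ∧ e.snd ∈ S := by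
    rcases SimpleGraph.dart_edge_eq_mk'_iff'.mp hedge with ⟨h₁, h₂⟩ | ⟨h₁, h₂⟩ <;>
      rw [h₁, h₂] <;> exact ⟨‹_›, ‹_›⟩
  obtain ⟨C, hC⟩ := hsurj ⟨e.snd, hends.2⟩
  have hfe : f C = e := hp.isCycle.dart_eq_of_snd_eq (hf C) he (congrArg Subtype.val hC)
  obtain ⟨hT, _⟩ := hfC C
  exact hdisj.notMem_of_mem_left hends.1 (hfe ▸ hT)
end

section
/- Let G be a simple graph whose vertex set is partitioned into two nonempty sets S and T such that the induced subgraph G[T] has exactly |S| connected components. Let G' be the graph obtained from G by adding all edges between pairs of distinct vertices of S. Then G is Hamiltonian if and only if G' is Hamiltonian. -/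
namespace SimpleGraph

/-- A cycle enters each vertex through only one of its darts. -/
theorem Walk.IsCycle.dart_eq_of_snd_eq_s11 {V : Type*} {G : SimpleGraph V} {v : V} {c : G.Walk v v}
    (hc : c.IsCycle) {d e : G.Dart} (hd : d ∈ c.darts) (he : e ∈ c.darts)
    (h : d.snd = e.snd) : d = e :=
  List.inj_on_of_nodup_map (c.map_snd_darts ▸ hc.support_nodup) hd he h

/-- A closed walk based outside `T` leaves every component of `G.induce T` that it visits, and
it does so towards a vertex outside `T`. -/
theorem Walk.exists_dart_leaving_component {V : Type*} [DecidableEq V] {G H : SimpleGraph V}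
    {T : Set V} (hadj : ∀ a ∈ T, ∀ b ∈ T, H.Adj a b → G.Adj a b) {s : V} (hs : s ∉ T)
    (c : H.Walk s s) (v : T) (hv : v.1 ∈ c.support) :
    ∃ d ∈ c.darts, (∃ h : d.fst ∈ T, (G.induce T).connectedComponentMk ⟨d.fst, h⟩ =
      (G.induce T).connectedComponentMk v) ∧ d.snd ∉ T := by
  obtain ⟨d, hd, ⟨hfst, hcomp⟩, hsnd⟩ := (c.dropUntil v.1 hv).exists_boundary_dart
    {x | ∃ h : x ∈ T, (G.induce T).connectedComponentMk ⟨x, h⟩ =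
      (G.induce T).connectedComponentMk v} ⟨v.2, rfl⟩ fun h => hs h.1
  refine ⟨d, c.darts_dropUntil_subset_darts hv hd, ⟨hfst, hcomp⟩, fun hT => hsnd ⟨hT, ?_⟩⟩
  rw [← hcomp]
  exact ConnectedComponent.connectedComponentMk_eq_of_adj
    (G := G.induce T) (hadj _ hfst _ hT d.adj).symm

end SimpleGraph

open SimpleGraph in
/-- Let the vertex set of `G` be partitioned into nonempty sets `S` and `T` such that
`G[T]` has exactly `|S|` connected components, and let `G'` be obtained from `G` by
adding all edges between pairs of distinct vertices of `S`. Then `G` is Hamiltonian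
if and only if `G'` is Hamiltonian. -/
theorem ham_iff_completion_of_S_ham {V : Type*} [Fintype V] [DecidableEq V]
    (G : SimpleGraph V) (S T : Set V)
    (hunion : S ∪ T = Set.univ) (hdisj : Disjoint S T)
    (hSne : S.Nonempty) (hTne : T.Nonempty)
    (hcomp : Nat.card (G.induce T).ConnectedComponent = S.ncard) :
    G.IsHamiltonian ↔
      (G ⊔ SimpleGraph.fromRel fun a b => a ∈ S ∧ b ∈ S).IsHamiltonian := by
  refine ⟨IsHamiltonian.mono le_sup_left, fun hG' _ => ?_⟩
  have mem_S {x : V} (hx : x ∉ T) : x ∈ S :=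
    (hunion.ge (Set.mem_univ x)).resolve_right hx
  have not_mem_T {x : V} (hx : x ∈ S) : x ∉ T := Set.disjoint_left.mp hdisj hx
  obtain ⟨s, hs⟩ := hSne
  obtain ⟨t, ht⟩ := hTne
  have : Nontrivial V := ⟨s, t, fun h => not_mem_T hs (h ▸ ht)⟩
  obtain ⟨c, hc⟩ := hG'.exists_isHamiltonianCycle s
  have hleave (C : (G.induce T).ConnectedComponent) : ∃ d ∈ c.darts,
      (∃ h : d.fst ∈ T, (G.induce T).connectedComponentMk ⟨d.fst, h⟩ = C) ∧ d.snd ∉ T := by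
    induction C using ConnectedComponent.ind with | h v
    refine c.exists_dart_leaving_component (fun a ha b hb hab => ?_) (not_mem_T hs) v
      (hc.mem_support _)
    rcases hab with hab | ⟨-, hab⟩
    · exact hab
    · rcases hab with hab | hab
      · exact (not_mem_T hab.1 ha).elim
      · exact (not_mem_T hab.1 hb).elim
  choose d hd hfst hsnd using hleave
  let F (C : (G.induce T).ConnectedComponent) : S := ⟨(d C).snd, mem_S (hsnd C)⟩
  have hinj : Function.Injective F := fun C D h => by
    obtain ⟨hC, hC'⟩ := hfst C
    obtain ⟨hD, hD'⟩ := hfst D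
    rw [← hC', ← hD']
    congr 2
    exact congrArg (·.fst) (hc.isCycle.dart_eq_of_snd_eq_s11 (hd _) (hd _) (Subtype.ext_iff.mp h))
  have hsurj : Function.Surjective F :=
    ((Nat.bijective_iff_injective_and_card F).mpr ⟨hinj, hcomp⟩).surjective
  have hedges : ∀ e ∈ c.edges, e ∈ G.edgeSet := by
    intro e he
    obtain ⟨a, ha, rfl⟩ := List.mem_map.mp he
    rcases a.adj with hadj | ⟨-, hadj⟩
    · exact hadj
    · have hS : a.fst ∈ S ∧ a.snd ∈ S := hadj.elim id And.symm
      obtain ⟨C, hC⟩ := hsurj ⟨a.snd, hS.2⟩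
      have := hc.isCycle.dart_eq_of_snd_eq_s11 (hd C) ha (Subtype.ext_iff.mp hC)
      exact (not_mem_T hS.1 (this ▸ (hfst C).1)).elim
  refine ⟨s, c.transfer G hedges, ?_⟩
  rw [Walk.isHamiltonianCycle_iff_isCycle_and_length_eq, Walk.length_transfer]
  exact ⟨hc.isCycle.transfer hedges, hc.length_eq⟩
end

section
/- Let G be a simple graph, let C be a cycle in G, and let v be a vertex not on C such that v has at least one neighbor and every neighbor of v lies on C. Fix a cyclic orientation of C, and let N⁺ denote the set of successors along C of the neighbors of v. Then either G contains a cycle of length |C| + 1, or N⁺ ∪ {v} is an independent set of G of size d(v) + 1. -/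
namespace SimpleGraph.Walk

variable {V : Type*} {G : SimpleGraph V}

/-- Joining both ends of a nontrivial path to a new vertex gives a cycle. -/
theorem IsPath.exists_isCycle_of_adj {x y v : V} {q : G.Walk x y} (hq : q.IsPath)
    (hlen : 1 ≤ q.length) (hv : v ∉ q.support) (hx : G.Adj v x) (hy : G.Adj v y) :
    ∃ (u : V) (c : G.Walk u u), c.IsCycle ∧ c.length = q.length + 2 := by
  refine ⟨v, cons hx (q.concat hy.symm), ?_, by simp⟩
  rw [cons_isCycle_iff]
  refine ⟨(concat_isPath_iff _).2 ⟨hq, hv⟩, ?_⟩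
  have hxy : x ≠ y := by
    rintro rfl
    have := (isPath_iff_nil.1 hq).length_eq_zero
    omega
  simp only [edges_concat, List.concat_eq_append, List.mem_append, List.mem_singleton, not_or]
  refine ⟨fun h => hv (q.fst_mem_support_of_mem_edges h), fun h => ?_⟩
  rcases Sym2.eq_iff.1 h with h | h
  · exact hx.ne h.2.symm
  · exact hxy h.2

/-- Reversing an initial segment of a path and reconnecting it by a chord gives a path with
the same vertices. -/
theorem IsPath.exists_isPath_reverse_take {x y : V} {q : G.Walk x y} (hq : q.IsPath) {k : ℕ}
    (hk : k < q.length) (hadj : G.Adj x (q.getVert (k + 1))) :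
    ∃ r : G.Walk (q.getVert k) y, r.IsPath ∧ r.length = q.length ∧ r.support ⊆ q.support := by
  let r := (q.take k).reverse.append (cons hadj (q.drop (k + 1)))
  have hlen : r.length = q.length := by
    simp [r, drop_length, take_length]; omega
  have hget (m : ℕ) : r.getVert m = if m ≤ k then q.getVert (k - m) else q.getVert m := by
    have hmin : min k q.length = k := by omega
    simp only [r, getVert_append, length_reverse, take_length, hmin, getVert_reverse,
      take_getVert]
    split_ifs with h1 h2 h2
    · congr 1; omega
    · omega
    · have : m = k := by omega
      simp [this]
    · rw [getVert_cons _ _ (by omega), drop_getVert]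
      congr 1; omega
  refine ⟨r, (IsPath.getVert_injOn_iff r).1 ?_, hlen, ?_⟩
  · intro m hm n hn h
    simp only [Set.mem_ofPred_eq, hlen] at hm hn
    rw [hget, hget] at h
    split_ifs at h <;>
    · have := hq.getVert_injOn (by simp only [Set.mem_ofPred_eq]; omega)
        (by simp only [Set.mem_ofPred_eq]; omega) h
      omega
  · intro w hw
    obtain ⟨m, rfl, -⟩ := mem_support_iff_exists_getVert.1 hw
    rw [hget]
    split_ifs <;> exact getVert_mem_support _ _

/-- Deleting an edge from a cycle leaves a path running from the successor of a vertex around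
the cycle back to that vertex. -/
theorem IsCycle.exists_isPath_getVert_succ {u : V} {c : G.Walk u u} (hc : c.IsCycle) {i : ℕ}
    (hi : i < c.length) :
    ∃ q : G.Walk (c.getVert (i + 1)) (c.getVert i), q.IsPath ∧ q.length + 1 = c.length ∧
      q.support ⊆ c.support ∧ ∀ m, i + 1 + m ≤ c.length → q.getVert m = c.getVert (i + 1 + m) := by
  let q := (c.drop (i + 1)).append (c.take i)
  have hlen : q.length + 1 = c.length := by
    simp [q, drop_length, take_length]; omega
  have hget (m : ℕ) (hm : m ≤ q.length) : q.getVert m =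
      c.getVert (if i + 1 + m ≤ c.length then i + 1 + m else i + 1 + m - c.length) := by
    simp only [q, getVert_append, drop_length, drop_getVert, take_getVert]
    split_ifs with h1 h2 h2
    · rfl
    · omega
    · have h3 : i + 1 + m = c.length := by omega
      have h4 : m - (c.length - (i + 1)) = 0 := by omega
      simp [h3, h4]
    · congr 1; omega
  refine ⟨q, (IsPath.getVert_injOn_iff q).1 ?_, hlen, ?_, ?_⟩
  · intro m hm n hn h
    simp only [Set.mem_ofPred_eq] at hm hn
    rw [hget m hm, hget n hn] at h
    have := hc.getVert_injOn (by simp only [Set.mem_ofPred_eq]; split_ifs <;> omega)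
      (by simp only [Set.mem_ofPred_eq]; split_ifs <;> omega) h
    split_ifs at this <;> omega
  · intro w hw
    obtain ⟨m, rfl, hm⟩ := mem_support_iff_exists_getVert.1 hw
    rw [hget m hm]
    exact getVert_mem_support _ _
  · intro m hm
    rw [hget m (by omega), if_pos hm]

/-- A vertex off a cycle that is adjacent to a vertex of the cycle and to its successor can be
inserted between them. -/
theorem IsCycle.exists_isCycle_of_adj_succ {u v : V} {c : G.Walk u u} (hc : c.IsCycle)
    (hv : v ∉ c.support) {i : ℕ} (hi : i < c.length) (h : G.Adj v (c.getVert i))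
    (h' : G.Adj v (c.getVert (i + 1))) :
    ∃ (u' : V) (c' : G.Walk u' u'), c'.IsCycle ∧ c'.length = c.length + 1 := by
  obtain ⟨q, hq, hlen, hsub, -⟩ := hc.exists_isPath_getVert_succ hi
  have := hc.three_le_length
  obtain ⟨u', c', hc', hl⟩ :=
    hq.exists_isCycle_of_adj (by omega) (fun hm => hv (hsub hm)) h' h
  exact ⟨u', c', hc', by omega⟩

/-- If a vertex off a cycle has two neighbors on the cycle whose successors are adjacent, then
there is a cycle with one more vertex. -/
theorem IsCycle.exists_isCycle_of_adj_succ_succ {u v : V} {c : G.Walk u u} (hc : c.IsCycle)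
    (hv : v ∉ c.support) {i j : ℕ} (hij : i < j) (hj : j < c.length)
    (hvi : G.Adj v (c.getVert i)) (hvj : G.Adj v (c.getVert j))
    (h : G.Adj (c.getVert (i + 1)) (c.getVert (j + 1))) :
    ∃ (u' : V) (c' : G.Walk u' u'), c'.IsCycle ∧ c'.length = c.length + 1 := by
  obtain ⟨q, hq, hlen, hsub, hget⟩ := hc.exists_isPath_getVert_succ (hij.trans hj)
  have := hc.three_le_length
  have hk : q.getVert (j - i - 1) = c.getVert j := by
    rw [hget _ (by omega)]; congr 1; omega
  have hk' : q.getVert (j - i - 1 + 1) = c.getVert (j + 1) := by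
    rw [hget _ (by omega)]; congr 1; omega
  obtain ⟨r, hr, hrl, hrs⟩ :=
    hq.exists_isPath_reverse_take (k := j - i - 1) (by omega) (hk' ▸ h)
  obtain ⟨u', c', hc', hl⟩ := hr.exists_isCycle_of_adj (by omega)
    (fun hm => hv (hsub (hrs hm))) (hk ▸ hvj) hvi
  exact ⟨u', c', hc', by omega⟩

/-- The successors on a cycle of the neighbors of a vertex are as many as these neighbors, if
the latter all lie on the cycle. -/
theorem IsCycle.ncard_succ_neighbors {u v : V} {c : G.Walk u u} (hc : c.IsCycle)
    [Fintype (G.neighborSet v)] (hN : ∀ w, G.Adj v w → w ∈ c.support) :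
    {y : V | ∃ i < c.length, G.Adj v (c.getVert i) ∧ y = c.getVert (i + 1)}.ncard =
      G.degree v := by
  let S : Set ℕ := {i | i < c.length ∧ G.Adj v (c.getVert i)}
  have hsucc : {y : V | ∃ i < c.length, G.Adj v (c.getVert i) ∧ y = c.getVert (i + 1)} =
      (fun i => c.getVert (i + 1)) '' S := by
    ext y
    simp only [S, Set.mem_image, Set.mem_ofPred_eq]
    exact ⟨fun ⟨i, h1, h2, h3⟩ => ⟨i, ⟨h1, h2⟩, h3.symm⟩,
      fun ⟨i, ⟨h1, h2⟩, h3⟩ => ⟨i, h1, h2, h3.symm⟩⟩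
  have hnbr : G.neighborSet v = c.getVert '' S := by
    ext w
    simp only [S, Set.mem_image, Set.mem_ofPred_eq, mem_neighborSet]
    refine ⟨fun hw => ?_, fun ⟨i, ⟨_, h⟩, hw⟩ => hw ▸ h⟩
    obtain ⟨i, rfl, hi⟩ := mem_support_iff_exists_getVert.1 (hN w hw)
    rcases hi.lt_or_eq with hi | rfl
    · exact ⟨i, ⟨hi, hw⟩, rfl⟩
    · have := hc.three_le_length
      exact ⟨0, ⟨by omega, by simpa using hw⟩, by simp⟩
  have hinj : Set.InjOn (fun i => c.getVert (i + 1)) S := by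
    intro i hi j hj h
    have := hc.getVert_injOn ⟨by omega, hi.1⟩ ⟨by omega, hj.1⟩ h
    omega
  have hinj' : Set.InjOn c.getVert S :=
    hc.getVert_injOn'.mono fun i hi => Nat.le_sub_one_of_lt hi.1
  rw [hsucc, hinj.ncard_image, ← hinj'.ncard_image, ← hnbr,
    ← G.card_neighborSet_eq_degree, Set.ncard_eq_toFinset_card', Set.toFinset_card]

end SimpleGraph.Walk

/-- Let `C` be a cycle in `G` and let `v` be a vertex not on `C` that has at least one
neighbor and all of whose neighbors lie on `C`. Let `N⁺` be the set of successors along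
(the cyclic orientation of) `C` of the neighbors of `v`. Then `G` contains a cycle of
length `|C| + 1`, or `N⁺ ∪ {v}` is an independent set of size `d(v) + 1`. -/
theorem extend_cycle_or_indep {V : Type*} [Fintype V] [DecidableEq V]
    (G : SimpleGraph V) [DecidableRel G.Adj]
    {u : V} (c : G.Walk u u) (hc : c.IsCycle)
    (v : V) (hv : v ∉ c.support)
    (hdeg : 0 < G.degree v)
    (hNC : ∀ w : V, G.Adj v w → w ∈ c.support)
    (Nplus : Set V)
    (hNplus : Nplus =
      {y : V | ∃ i < c.length, G.Adj v (c.getVert i) ∧ y = c.getVert (i + 1)}) :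
    (∃ (u' : V) (c' : G.Walk u' u'), c'.IsCycle ∧ c'.length = c.length + 1) ∨
    ((Nplus ∪ {v}).ncard = G.degree v + 1 ∧
      ∀ a ∈ Nplus ∪ {v}, ∀ b ∈ Nplus ∪ {v}, a ≠ b → ¬ G.Adj a b) := by
  subst hNplus
  by_cases hcyc : ∃ (u' : V) (c' : G.Walk u' u'), c'.IsCycle ∧ c'.length = c.length + 1
  · exact Or.inl hcyc
  refine Or.inr ⟨?_, ?_⟩
  · rw [Set.union_singleton, Set.ncard_insert_of_notMem ?_ (Set.toFinite _),
      hc.ncard_succ_neighbors hNC]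
    rintro ⟨i, -, -, h⟩
    exact hv (h ▸ c.getVert_mem_support _)
  · rintro a (⟨i, hi, hvi, rfl⟩ | rfl) b (⟨j, hj, hvj, rfl⟩ | rfl) hne hab
    · rcases lt_trichotomy i j with hij | rfl | hij
      · exact hcyc (hc.exists_isCycle_of_adj_succ_succ hv hij hj hvi hvj hab)
      · exact hne rfl
      · exact hcyc (hc.exists_isCycle_of_adj_succ_succ hv hij hi hvj hvi hab.symm)
    · exact hcyc (hc.exists_isCycle_of_adj_succ hv hi hvi hab.symm)
    · exact hcyc (hc.exists_isCycle_of_adj_succ hv hj hvj hab)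
    · exact hne rfl
end

section
/- Let G be a simple graph whose vertex set is partitioned into sets P and K with |P| ≥ 2 and |K| ≥ 2, such that K induces a clique in G, and such that the only edges of G between P and K are u₁v₁ and u₂v₂, where u₁ ≠ u₂ are vertices of P and v₁ ≠ v₂ are vertices of K. Then G is Hamiltonian if and only if the induced subgraph G[P] contains a Hamiltonian path with endpoints u₁ and u₂. -/
namespace SimpleGraph.Walk

variable {V : Type*} {G : SimpleGraph V}

/-- If every edge of a walk leaving `P` does so at `u`, then the walk stays outside `P` once it
starts there and avoids `u`. -/
theorem notMem_of_mem_support_of_cut {P : Set V} {u a b : V} (s : G.Walk a b) (ha : a ∉ P)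
    (hu : u ∉ s.support) (hcut : ∀ x ∈ P, ∀ y ∉ P, s(x, y) ∈ s.edges → x = u) :
    ∀ x ∈ s.support, x ∉ P := by
  induction s with
  | nil => simpa using ha
  | @cons a c b h s ih =>
    have hc : c ∉ P := fun hc ↦ by
      obtain rfl := hcut c hc a ha (by simp [Sym2.eq_swap])
      simp at hu
    rw [support_cons, List.mem_cons, not_or] at hu
    have := ih hc hu.2 fun x hx y hy he ↦ hcut x hx y hy (by simp [he])
    grind [support_cons]

/-- A path leaving `P` only at `u` begins with a path inside `P` ending at `u` that collects all
the vertices of `P` on it. -/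
theorem IsPath.exists_induce_of_cut {P : Set V} {u a b : V} (hu : u ∈ P) {s : G.Walk a b}
    (hs : s.IsPath) (ha : a ∈ P) (hb : b ∉ P)
    (hcut : ∀ x ∈ P, ∀ y ∉ P, s(x, y) ∈ s.edges → x = u) :
    ∃ t : (G.induce P).Walk ⟨a, ha⟩ ⟨u, hu⟩,
      t.IsPath ∧ ∀ x : P, x ∈ t.support ↔ (x : V) ∈ s.support := by
  induction s with
  | nil => exact absurd ha hb
  | @cons a c b h s ih =>
    rw [cons_isPath_iff] at hs
    have hcut' : ∀ x ∈ P, ∀ y ∉ P, s(x, y) ∈ s.edges → x = u :=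
      fun x hx y hy he ↦ hcut x hx y hy (by simp [he])
    by_cases hc : c ∈ P
    · obtain ⟨t, ht, hts⟩ := ih hs.1 hc hb hcut'
      refine ⟨cons (show (G.induce P).Adj ⟨a, ha⟩ ⟨c, hc⟩ from h) t,
        ht.cons (by simpa [hts] using hs.2), fun x ↦ ?_⟩
      simp [hts, Subtype.ext_iff]
    · obtain rfl := hcut a ha c hc (by simp)
      refine ⟨Walk.nil, .nil, fun x ↦ ?_⟩
      have := notMem_of_mem_support_of_cut s hc hs.2 hcut' x
      simp only [support_nil, support_cons, List.mem_cons, Subtype.ext_iff]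
      grind [start_mem_support]

/-- A path containing the edge between its endpoints is that edge. -/
theorem IsPath.support_eq_pair {a b : V} {p : G.Walk a b} (hp : p.IsPath)
    (he : s(a, b) ∈ p.edges) : p.support = [a, b] := by
  cases p with
  | nil => simp at he
  | @cons _ c _ h q =>
    rw [cons_isPath_iff] at hp
    rw [edges_cons, List.mem_cons] at he
    rcases he with he | he
    · obtain rfl : b = c := Sym2.congr_right.1 he
      simp [nil_iff_support_eq.1 (isPath_iff_nil.1 hp.1)]
    · exact absurd (q.fst_mem_support_of_mem_edges he) hp.2

/-- If the only edges leaving `P` are `a₁b₁` and `a₂b₂`, then a Hamiltonian cycle at `a₁` yields a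
Hamiltonian path from `a₁` to `b₁` that avoids the edge `a₁b₁`. -/
theorem IsHamiltonianCycle.exists_isHamiltonian_notMem_edges [DecidableEq V] {P : Set V}
    {a₁ a₂ b₁ b₂ : V} {c : G.Walk a₁ a₁} (hc : c.IsHamiltonianCycle) (ha : a₁ ∈ P) (hb : b₁ ∉ P)
    (hcut : ∀ x ∈ P, ∀ y ∉ P, G.Adj x y → x = a₁ ∧ y = b₁ ∨ x = a₂ ∧ y = b₂) :
    ∃ s : G.Walk a₁ b₁, s.IsHamiltonian ∧ s(a₁, b₁) ∉ s.edges := by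
  have hmem := hc.mem_support b₁
  have hspec := c.take_spec hmem
  have hr := hc.isCycle.isPath_takeUntil hmem
  have hdisj := hc.isCycle.isTrail.disjoint_edges_takeUntil_dropUntil hmem
  have hs : (c.dropUntil b₁ hmem).IsPath :=
    (hspec ▸ hc.isCycle).isPath_of_append_right (not_nil_of_ne (ne_of_mem_of_not_mem ha hb))
  generalize c.takeUntil b₁ hmem = r at *
  generalize c.dropUntil b₁ hmem = s at *
  have hall (x : V) : x ∈ r.support ∨ x ∈ s.support := by
    simpa [← hspec] using hc.mem_support x
  have hcross (q : G.Walk a₁ b₁) : s(a₁, b₁) ∈ q.edges ∨ s(a₂, b₂) ∈ q.edges := by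
    obtain ⟨⟨⟨x, y⟩, hxy⟩, hd, hx, hy⟩ := q.exists_boundary_dart P ha hb
    have he : s(x, y) ∈ q.edges := List.mem_map_of_mem (f := Dart.edge) hd
    rcases hcut x hx y hy hxy with ⟨rfl, rfl⟩ | ⟨rfl, rfl⟩
    · exact .inl he
    · exact .inr he
  by_cases he : s(a₁, b₁) ∈ r.edges
  · refine ⟨s.reverse, hs.reverse.isHamiltonian_of_mem fun x ↦ ?_, ?_⟩
    · have := hall x
      grind [hr.support_eq_pair he, support_reverse, start_mem_support, end_mem_support]
    · simpa using fun h ↦ hdisj he h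
  · refine ⟨r, hr.isHamiltonian_of_mem fun x ↦ ?_, he⟩
    have hs' := hcross s.reverse
    have hr' := hcross r
    rw [edges_reverse, List.mem_reverse, List.mem_reverse] at hs'
    have h₁ : s(b₁, a₁) ∈ s.edges := by
      rw [Sym2.eq_swap]
      exact hs'.resolve_right fun h ↦ hdisj (hr'.resolve_left he) h
    have := hall x
    grind [hs.support_eq_pair h₁, start_mem_support, end_mem_support]

/-- The vertices of a finite clique can be arranged into a path with prescribed distinct
endpoints. -/
theorem _root_.SimpleGraph.IsClique.exists_isPath_support {K : Set V} (hK : G.IsClique K)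
    (hfin : K.Finite) {a b : V} (ha : a ∈ K) (hb : b ∈ K) (hab : a ≠ b) :
    ∃ p : G.Walk a b, p.IsPath ∧ ∀ x, x ∈ p.support ↔ x ∈ K := by
  classical
  let l := a :: (hfin.toFinset \ {a, b}).toList ++ [b]
  have hl (x : V) : x ∈ l ↔ x ∈ K := by
    simp only [l, List.cons_append, List.mem_cons, List.mem_append, Finset.mem_toList,
      Finset.mem_sdiff, Set.Finite.mem_toFinset, Finset.mem_insert, Finset.mem_singleton,
      List.not_mem_nil]
    grind
  have hnodup : l.Nodup := by
    have := (hfin.toFinset \ {a, b}).nodup_toList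
    simp only [l, List.cons_append, List.nodup_cons, List.nodup_append]
    simp [hab, this]
  have hchain : l.IsChain G.Adj :=
    (hnodup.pairwise_of_forall_ne fun x hx y hy hxy ↦
      hK ((hl x).1 hx) ((hl y).1 hy) hxy).isChain
  obtain ⟨p, hp⟩ : ∃ p : G.Walk a b, p.support = l :=
    ⟨(ofSupport l (by simp [l]) hchain).copy (by simp [l]) (by simp [l]),
      (support_copy _ _ _).trans (support_ofSupport _ _)⟩
  exact ⟨p, (isPath_def p).2 (hp ▸ hnodup), hp ▸ hl⟩

end SimpleGraph.Walk

/-- Let the vertex set of `G` be partitioned into `P` and `K` with `|P| ≥ 2`, `|K| ≥ 2`,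
where `K` induces a clique and the only edges between `P` and `K` are `u₁v₁` and `u₂v₂`
(with `u₁ ≠ u₂` in `P` and `v₁ ≠ v₂` in `K`). Then `G` is Hamiltonian if and only if
`G[P]` contains a Hamiltonian path with endpoints `u₁` and `u₂`. -/
theorem ham_iff_ham_path_pendant_clique {V : Type*} [Fintype V] [DecidableEq V]
    (G : SimpleGraph V) (P K : Set V)
    (hunion : P ∪ K = Set.univ) (hdisj : Disjoint P K)
    (hPcard : 2 ≤ P.ncard) (hKcard : 2 ≤ K.ncard)
    (hclique : G.IsClique K)
    (u₁ u₂ v₁ v₂ : V)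
    (hu₁ : u₁ ∈ P) (hu₂ : u₂ ∈ P) (hu : u₁ ≠ u₂)
    (hv₁ : v₁ ∈ K) (hv₂ : v₂ ∈ K) (hv : v₁ ≠ v₂)
    (hbridge : ∀ a ∈ P, ∀ b ∈ K,
      (G.Adj a b ↔ (a = u₁ ∧ b = v₁) ∨ (a = u₂ ∧ b = v₂))) :
    G.IsHamiltonian ↔
      ∃ p : (G.induce P).Walk ⟨u₁, hu₁⟩ ⟨u₂, hu₂⟩, p.IsHamiltonian := by
  have hK (x : V) : x ∉ P ↔ x ∈ K := by
    obtain rfl : K = Pᶜ := (IsCompl.compl_eq ⟨hdisj, codisjoint_iff.2 hunion⟩).symm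
    rfl
  have hv₁P := (hK v₁).2 hv₁
  have hv₂P := (hK v₂).2 hv₂
  have hadj₁ : G.Adj u₁ v₁ := (hbridge _ hu₁ _ hv₁).2 (.inl ⟨rfl, rfl⟩)
  have hadj₂ : G.Adj u₂ v₂ := (hbridge _ hu₂ _ hv₂).2 (.inr ⟨rfl, rfl⟩)
  constructor
  · intro hG
    have : Nontrivial V := ⟨u₁, u₂, hu⟩
    obtain ⟨c, hc⟩ := hG.exists_isHamiltonianCycle u₁
    have hcut : ∀ x ∈ P, ∀ y ∉ P, G.Adj x y → x = u₁ ∧ y = v₁ ∨ x = u₂ ∧ y = v₂ :=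
      fun x hx y hy ↦ (hbridge x hx y ((hK y).1 hy)).1
    obtain ⟨s, hs, he⟩ := hc.exists_isHamiltonian_notMem_edges hu₁ hv₁P hcut
    obtain ⟨t, ht, hts⟩ := hs.isPath.exists_induce_of_cut hu₂ hu₁ hv₁P fun x hx y hy hxy ↦ by
      rcases hcut x hx y hy (s.adj_of_mem_edges hxy) with ⟨rfl, rfl⟩ | h
      · exact absurd hxy he
      · exact h.1
    exact ⟨t, ht.isHamiltonian_of_mem fun x ↦ (hts x).2 (hs.mem_support x)⟩
  · rintro ⟨t, ht⟩ -
    obtain ⟨k, hk, hkK⟩ := hclique.exists_isPath_support K.toFinite hv₂ hv₁ hv.symm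
    obtain ⟨t', ht', htP⟩ : ∃ t' : G.Walk u₁ u₂, t'.IsPath ∧ ∀ x, x ∈ t'.support ↔ x ∈ P := by
      let i := SimpleGraph.Embedding.induce (G := G) P
      refine ⟨t.map i.toHom, ht.isPath.map i.injective, fun x ↦ ?_⟩
      erw [SimpleGraph.Walk.support_map]
      simp [i, ht.mem_support]
    let q : G.Walk u₁ v₁ := t'.append (.cons hadj₂ k)
    have hqs : q.support = t'.support ++ k.support := by
      simp [q, SimpleGraph.Walk.support_append]
    have hq : q.IsPath := by
      rw [SimpleGraph.Walk.isPath_def, hqs, List.nodup_append']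
      exact ⟨ht'.support_nodup, hk.support_nodup,
        fun x hx hx' ↦ (hK x).2 ((hkK x).1 hx') ((htP x).1 hx)⟩
    have hqH : q.IsHamiltonian := hq.isHamiltonian_of_mem fun x ↦ by
      rw [hqs, List.mem_append, htP, hkK, ← hK]
      exact em _
    refine ⟨v₁, .cons hadj₁.symm q, ?_, ?_⟩
    · refine (q.cons_isCycle_iff _).2 ⟨hq, fun he ↦ ?_⟩
      have := hqH.mem_support u₂
      rw [hq.support_eq_pair (Sym2.eq_swap ▸ he)] at this
      grind
    · simpa [SimpleGraph.Walk.IsHamiltonian] using hqH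
end
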